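/- arXiv:math/9703224 — 2 statements merged into one kernel-verified Lean document; each statement's English description precedes it below -/
import Mathlib

section
/- Let h ∈ ℂ[X,Y] be non-zero and let S be a segment of its right Newton polygon. Then, counting multiplicities, the equation h(X,Y) = 0 has exactly |S₂| non-zero solutions a(X) ∈ ℂ((1/X))* of degree (|S₁|/|S₂|)·σ(S); moreover if (Y − cX^θ)^k divides in(h,S) in ℂ((1/X))*[Y] with θ = (|S₁|/|S₂|)·σ(S), then exactly k of these solutions (with multiplicity) have leading term cX^θ. -/
open scoped Classical

noncomputable section

/-- A (candidate) segment in the plane, given by its two lattice endpoints. -/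
structure Seg where
  P : ℕ × ℕ
  Q : ℕ × ℕ

/-- the support of a polynomial in two variables, as a finite set of pairs `(α,β)`. -/
def supp (h : MvPolynomial (Fin 2) ℂ) : Finset (ℕ × ℕ) :=
  h.support.image fun d => (d 0, d 1)

/-- the coefficient `h_{αβ}` of `X^α Y^β` in `h`. -/
def coeff2 (h : MvPolynomial (Fin 2) ℂ) (p : ℕ × ℕ) : ℂ :=
  MvPolynomial.coeff (Finsupp.single 0 p.1 + Finsupp.single 1 p.2) h

/-- the linear functional whose level lines are parallel to `S`, normalized so that
(for a right-polygon segment, `S.P.2 < S.Q.2`) its gradient points to the right. -/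
def lfun (S : Seg) (v : ℕ × ℕ) : ℤ :=
  ((S.Q.2 : ℤ) - S.P.2) * v.1 - ((S.Q.1 : ℤ) - S.P.1) * v.2

/-- the linear functional whose level lines are parallel to `S`, normalized so that
(for a top-polygon segment, `S.P.1 < S.Q.1`) its gradient points upwards. -/
def gfun (S : Seg) (v : ℕ × ℕ) : ℤ :=
  ((S.Q.1 : ℤ) - S.P.1) * v.2 - ((S.Q.2 : ℤ) - S.P.2) * v.1

/-- `v` lies on the segment with endpoints `S.P` and `S.Q`
(collinear and inside the bounding box). -/
def OnSeg (S : Seg) (v : ℕ × ℕ) : Prop :=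
  lfun S v = lfun S S.P ∧
  min S.P.1 S.Q.1 ≤ v.1 ∧ v.1 ≤ max S.P.1 S.Q.1 ∧
  min S.P.2 S.Q.2 ≤ v.2 ∧ v.2 ≤ max S.P.2 S.Q.2

/-- `S` is a segment (one-dimensional boundary face) of the right Newton polygon of `h`:
its endpoints (ordered by increasing ordinate) are in the support, the whole support lies
weakly to the left of the line through `S` (the supporting line has outward normal with
positive first coordinate), and `S` is a maximal face: every support point on this line has
ordinate between those of the endpoints. Such segments are exactly the boundary faces on
the right of the Newton diagram joining the lines `β = ord_Y h` and `β = deg_Y h`. -/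
def RightSeg (h : MvPolynomial (Fin 2) ℂ) (S : Seg) : Prop :=
  S.P ∈ supp h ∧ S.Q ∈ supp h ∧ S.P.2 < S.Q.2 ∧
  (∀ v ∈ supp h, lfun S v ≤ lfun S S.P) ∧
  (∀ v ∈ supp h, lfun S v = lfun S S.P → S.P.2 ≤ v.2 ∧ v.2 ≤ S.Q.2)

/-- `S` is a segment of the top Newton polygon of `h` (endpoints ordered by increasing
abscissa; the supporting line has outward normal with positive second coordinate). -/
def TopSeg (h : MvPolynomial (Fin 2) ℂ) (S : Seg) : Prop :=
  S.P ∈ supp h ∧ S.Q ∈ supp h ∧ S.P.1 < S.Q.1 ∧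
  (∀ v ∈ supp h, gfun S v ≤ gfun S S.P) ∧
  (∀ v ∈ supp h, gfun S v = gfun S S.P → S.P.1 ≤ v.1 ∧ v.1 ≤ S.Q.1)

/-- `σ(S)` for a right-polygon segment (endpoints ordered by increasing ordinate):
`0` if `S` is vertical, otherwise minus the sign of the slope of `S`. -/
def sigmaR (S : Seg) : ℤ :=
  if S.P.1 = S.Q.1 then 0 else if S.P.1 < S.Q.1 then -1 else 1

/-- `σ(S)` for a top-polygon segment (endpoints ordered by increasing abscissa). -/
def sigmaT (S : Seg) : ℤ :=
  if S.P.2 = S.Q.2 then 0 else if S.P.2 < S.Q.2 then -1 else 1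

/-- `|S₁|`, the length of the projection of `S` on the horizontal axis. -/
def len1 (S : Seg) : ℚ := |(S.Q.1 : ℚ) - S.P.1|

/-- `|S₂|`, the length of the projection of `S` on the vertical axis. -/
def len2 (S : Seg) : ℚ := |(S.Q.2 : ℚ) - S.P.2|

/-- the declivity `(|S₁|/|S₂|)·σ(S)` of a right-polygon segment. -/
def decl (S : Seg) : ℚ := len1 S / len2 S * (sigmaR S : ℚ)

/-- the declivity `(|S₂|/|S₁|)·σ(S)` of a top-polygon segment. -/
def tdecl (S : Seg) : ℚ := len2 S / len1 S * (sigmaT S : ℚ)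

/-- `α(S)`: the abscissa of the intersection of the line through `S` with the
horizontal axis. -/
def alphaS (S : Seg) : ℚ := (S.P.1 : ℚ) + (S.P.2 : ℚ) * decl S

/-- `β(S)`: the ordinate of the intersection of the line through `S` with the
vertical axis. -/
def betaS (S : Seg) : ℚ := (S.P.2 : ℚ) + (S.P.1 : ℚ) * tdecl S

/-- a right-polygon segment is exceptional if it joins the horizontal axis with a
point of the form `(p, 1)`. -/
def RExcep (S : Seg) : Prop := S.P.2 = 0 ∧ S.Q.2 = 1

/-- a top-polygon segment is exceptional if it joins the vertical axis with a
point of the form `(1, q)`. -/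
def TExcep (S : Seg) : Prop := S.P.1 = 0 ∧ S.Q.1 = 1

/-- `in(h,S)`: the sum of the monomials of `h` supported on the segment `S`. -/
def inPoly (h : MvPolynomial (Fin 2) ℂ) (S : Seg) : MvPolynomial (Fin 2) ℂ :=
  ∑ p ∈ (supp h).filter (OnSeg S),
    MvPolynomial.monomial (Finsupp.single 0 p.1 + Finsupp.single 1 p.2) (coeff2 h p)

/-! Laurent–Puiseux series in `1/X` are modelled as Hahn series over `ℚᵒᵈ`:
formal series `∑ a_θ X^θ` with complex coefficients whose rational exponents form a
set that is well-ordered downwards (in particular bounded above); this field contains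
`ℂ((1/X))* = ⋃_k ℂ((X^(−1/k)))` and is algebraically closed. -/
abbrev K : Type := HahnSeries ℚᵒᵈ ℂ

/-- the degree of a Laurent–Puiseux series: its largest exponent. -/
def degLP (a : K) : ℚ := OrderDual.ofDual a.order

/-- `a⁺`, the leading term of a Laurent–Puiseux series. -/
def lead (a : K) : K := HahnSeries.single a.order a.leadingCoeff

/-- `X^θ` as a Laurent–Puiseux series. -/
def XpowQ (θ : ℚ) : K := HahnSeries.single (OrderDual.toDual θ) 1

/-- the substitution `h(X, a(X))` of a Laurent–Puiseux series for `Y` in `h`. -/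
def substY (h : MvPolynomial (Fin 2) ℂ) (a : K) : K :=
  ∑ p ∈ supp h,
    (HahnSeries.single (OrderDual.toDual (p.1 : ℚ)) (coeff2 h p) : K) * a ^ p.2

/-- the substitution `in(h,S)(X, a(X))` of a Laurent–Puiseux series for `Y` in `in(h,S)`. -/
def inSub (h : MvPolynomial (Fin 2) ℂ) (S : Seg) (a : K) : K :=
  ∑ p ∈ (supp h).filter (OnSeg S),
    (HahnSeries.single (OrderDual.toDual (p.1 : ℚ)) (coeff2 h p) : K) * a ^ p.2

/-- `h` viewed as a polynomial in `Y` over the Laurent–Puiseux field `K`. -/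
def polyY (h : MvPolynomial (Fin 2) ℂ) : Polynomial K :=
  ∑ p ∈ supp h,
    Polynomial.C (HahnSeries.single (OrderDual.toDual (p.1 : ℚ)) (coeff2 h p) : K) *
      Polynomial.X ^ p.2

/-- `in(h,S)` viewed as a polynomial in `Y` over the Laurent–Puiseux field `K`. -/
def inPolyY (h : MvPolynomial (Fin 2) ℂ) (S : Seg) : Polynomial K :=
  ∑ p ∈ (supp h).filter (OnSeg S),
    Polynomial.C (HahnSeries.single (OrderDual.toDual (p.1 : ℚ)) (coeff2 h p) : K) *
      Polynomial.X ^ p.2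

open Polynomial in
theorem hensel_factor {A : Type*} [CommRing A] [IsLocalRing A]
    [IsAdicComplete (IsLocalRing.maximalIdeal A) A] (f : A[X]) (n : ℕ) (hf : f.Monic)
    (hn : f.natDegree = n) (h0 : f.coeff 0 ∈ IsLocalRing.maximalIdeal A)
    (j : ℕ) (hj : j < n) (hj' : f.coeff j ∉ IsLocalRing.maximalIdeal A) :
    ∃ g q : A[X], g.Monic ∧ q.Monic ∧ f = g * q ∧ g.natDegree < n ∧ q.natDegree < n := by
  set m := IsLocalRing.maximalIdeal A with hm
  have hmt : m ≠ ⊤ := (IsLocalRing.maximalIdeal.isMaximal A).ne_top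
  have hcoef : ∀ i, PowerSeries.coeff i ((f : PowerSeries A).map (IsLocalRing.residue A)) = 0 ↔
      f.coeff i ∈ m := by
    intro i
    rw [PowerSeries.coeff_map, Polynomial.coeff_coe, IsLocalRing.residue_eq_zero_iff]
  have hne : (f : PowerSeries A).map (IsLocalRing.residue A) ≠ 0 := by
    intro h
    apply hj'
    rw [← hcoef, h]; simp
  obtain ⟨g, u, H⟩ := PowerSeries.exists_isWeierstrassFactorization hne
  have hdeg := H.natDegree_eq_toNat_order_map_of_ne_top hmt
  have hgm := H.isDistinguishedAt.monic
  have hord := (PowerSeries.order_finite_iff_ne_zero.2 hne)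
  change _ = ((f : PowerSeries A).map (IsLocalRing.residue A)).order.toNat at hdeg
  have hle : g.natDegree ≤ j := by
    by_contra hlt
    push Not at hlt
    rw [hdeg] at hlt
    exact hj' ((hcoef j).1 (PowerSeries.coeff_of_lt_order_toNat _ hlt))
  have hpos : 0 < g.natDegree := by
    by_contra hlt
    have h0' : g.natDegree = 0 := by omega
    rw [hdeg] at h0'
    have := PowerSeries.coeff_order hne
    rw [h0'] at this
    exact this ((hcoef 0).2 h0)
  have hW := H.isDistinguishedAt.isWeierstrassDivisorAt hmt
  have hgord0 := H.isDistinguishedAt.coe_natDegree_eq_order_map g 1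
    (by rwa [map_one, ← Ideal.ne_top_iff_one]) (by simp)
  have hgord := congrArg ENat.toNat hgord0
  rw [ENat.toNat_coe] at hgord
  have hnt : Nontrivial A := inferInstance
  have key := hW.eq_of_mul_add_eq_mul_add (q := u) (q' := ((f /ₘ g : A[X]) : PowerSeries A)) (r := 0)
    (r' := f %ₘ g) (by simp) (by
      have := degree_modByMonic_lt f hgm
      rw [degree_eq_natDegree hgm.ne_zero, hgord] at this
      exact this) (by
      rw [← H.eq_mul]
      conv_lhs => rw [← modByMonic_add_div f g]
      simp [add_comm])
  have hfe : f = g * (f /ₘ g) := by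
    conv_lhs => rw [← modByMonic_add_div f g, ← key.2, zero_add]
  have hqm : (f /ₘ g).Monic := by
    rw [hfe] at hf
    exact hgm.of_mul_monic_left hf
  refine ⟨g, f /ₘ g, hgm, hqm, hfe, by omega, ?_⟩
  have : f.natDegree = g.natDegree + (f /ₘ g).natDegree := by
    conv_lhs => rw [hfe, hgm.natDegree_mul hqm]
  omega

open Polynomial in
theorem taylor_coeff_pred {A : Type*} [CommRing A] (f : A[X]) (n : ℕ) (hf : f.Monic)
    (hn : f.natDegree = n + 1) (b : A) :
    (taylor b f).coeff n = f.coeff n + (n + 1) * b := by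
  rw [taylor_coeff]
  have hd : (hasseDeriv n f).natDegree < 2 := by
    have := natDegree_hasseDeriv_le f n
    omega
  rw [eval_eq_sum_range' hd]
  have : f.coeff (n+1) = 1 := by rw [← hn]; exact hf
  simp [Finset.sum_range_succ, hasseDeriv_coeff, add_comm 1 n, this]

instance psComplete : IsAdicComplete (IsLocalRing.maximalIdeal (PowerSeries ℂ)) (PowerSeries ℂ) := by
  rw [PowerSeries.maximalIdeal_eq_span_X]; infer_instance

/-- `T ↦ X^(-r)`. -/
def phi (r : ℚ) (hr : 0 < r) : PowerSeries ℂ →+* K :=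
  (HahnSeries.embDomainRingHom
    ({ toFun := fun n => OrderDual.toDual (-(r * n)), map_zero' := by simp, map_add' := by
        intro x y; rw [← toDual_add]; congr 1; push_cast; ring } : ℕ →+ ℚᵒᵈ)
    (fun a b h => by
      have h' : -(r * (a:ℚ)) = -(r * b) := OrderDual.toDual.injective h
      have := mul_left_cancel₀ hr.ne' (neg_injective h')
      exact_mod_cast this)
    (fun a b => by
      change OrderDual.toDual (-(r * (a:ℚ))) ≤ OrderDual.toDual (-(r * b)) ↔ _
      rw [OrderDual.toDual_le_toDual, neg_le_neg_iff, mul_le_mul_iff_right₀ hr]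
      exact Nat.cast_le)).comp
    (RingEquiv.toRingHom HahnSeries.toPowerSeries.symm)

theorem phi_coeff (r : ℚ) (hr : 0 < r) (f : PowerSeries ℂ) (n : ℕ) :
    (phi r hr f).coeff (OrderDual.toDual (-(r * n))) = PowerSeries.coeff n f :=
  HahnSeries.embDomain_mk_coeff (f := fun n : ℕ => OrderDual.toDual (-(r * (n:ℚ)))) _ _

theorem phi_coeff' (r : ℚ) (hr : 0 < r) (f : PowerSeries ℂ) (e : ℚ) (he : ∀ n : ℕ, e ≠ -(r * n)) :
    (phi r hr f).coeff (OrderDual.toDual e) = 0 := by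
  apply HahnSeries.embDomain_of_notMem_range
  rintro ⟨n, hn⟩
  exact he n (OrderDual.toDual.injective hn.symm)

theorem phi_injective (r : ℚ) (hr : 0 < r) : Function.Injective (phi r hr) := by
  intro f g h
  ext n
  rw [← phi_coeff r hr, h, phi_coeff]

theorem phi_expand (r : ℚ) (hr : 0 < r) (q : ℕ) (hq : q ≠ 0) (hr' : 0 < r / q) (f : PowerSeries ℂ) :
    phi r hr f = phi (r / q) hr' (PowerSeries.expand q hq f) := by
  have hq' : (q : ℚ) ≠ 0 := by exact_mod_cast hq
  ext e
  induction e using OrderDual.rec with | _ e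
  by_cases h : ∃ n : ℕ, e = -(r / q * n)
  · obtain ⟨n, rfl⟩ := h
    rw [phi_coeff]
    by_cases hd : q ∣ n
    · obtain ⟨k, rfl⟩ := hd
      rw [PowerSeries.coeff_expand_mul, ← phi_coeff r hr]
      congr 2
      push_cast; field_simp
    · rw [PowerSeries.coeff_expand_of_not_dvd _ _ _ hd, phi_coeff']
      intro k hk
      apply hd
      use k
      have : (n : ℚ) = q * k := by
        field_simp at hk
        linarith
      exact_mod_cast this
  · push Not at h
    rw [phi_coeff' _ _ _ _ h, phi_coeff']
    intro k hk
    apply h (q * k)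
    rw [hk]; push_cast; field_simp
open Polynomial in
theorem ps_mem_max (a : PowerSeries ℂ) :
    a ∈ IsLocalRing.maximalIdeal (PowerSeries ℂ) ↔ PowerSeries.constantCoeff a = 0 := by
  rw [PowerSeries.maximalIdeal_eq_span_X, Ideal.mem_span_singleton, PowerSeries.X_dvd_iff]

open Polynomial in
/-- If `g` is monic of degree `n+1`, with zero next coefficient but nonzero reduction below,
then a shift of it factors. -/
theorem exists_factor (g : (PowerSeries ℂ)[X]) (n : ℕ) (hg : g.Monic) (hn : g.natDegree = n + 1)
    (h1 : g.coeff n = 0) (j : ℕ) (hj : j < n + 1)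
    (hj' : PowerSeries.constantCoeff (g.coeff j) ≠ 0) :
    ∃ (c : PowerSeries ℂ) (u v : (PowerSeries ℂ)[X]), u.Monic ∧ v.Monic ∧ taylor c g = u * v ∧
      u.natDegree < n + 1 ∧ v.natDegree < n + 1 := by
  set gb : ℂ[X] := g.map PowerSeries.constantCoeff with hgb
  have hgbm : gb.Monic := hg.map _
  have hgbn : gb.natDegree = n + 1 := by rw [hgb, hg.natDegree_map, hn]
  obtain ⟨c, hc⟩ := IsAlgClosed.exists_root gb (by
    rw [degree_eq_natDegree hgbm.ne_zero, hgbn]; exact_mod_cast (Nat.succ_ne_zero n))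
  have hmap : (taylor (PowerSeries.C c) g).map PowerSeries.constantCoeff = taylor c gb := by
    rw [map_taylor]; simp [hgb]
  have htm : (taylor (PowerSeries.C c) g).Monic := by
    rw [Monic, leadingCoeff_taylor]; exact hg
  have htn : (taylor (PowerSeries.C c) g).natDegree = n + 1 := by rw [natDegree_taylor, hn]
  have hex : ∃ i < n + 1, (taylor c gb).coeff i ≠ 0 := by
    by_contra hcon
    push Not at hcon
    have h2 := hcon n (by omega)
    rw [taylor_coeff_pred gb n hgbm hgbn, hgb, coeff_map, h1, map_zero, zero_add, mul_eq_zero] at h2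
    have hc0 : c = 0 := h2.resolve_left (by exact_mod_cast (Nat.succ_ne_zero n))
    have h3 := hcon j hj
    rw [hc0, taylor_zero, hgb, coeff_map] at h3
    exact hj' h3
  obtain ⟨i, hi, hi'⟩ := hex
  obtain ⟨u, v, hu, hv, huv, hd1, hd2⟩ := hensel_factor (taylor (PowerSeries.C c) g) (n+1) htm htn (by
    rw [ps_mem_max, ← coeff_map, hmap, taylor_coeff_zero]; exact hc) i hi (by
    rw [ps_mem_max, ← coeff_map, hmap]; exact hi')
  exact ⟨_, u, v, hu, hv, huv, hd1, hd2⟩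

open Polynomial in
theorem splits_of_taylor (F : K[X]) (c : K) (h : (taylor c F).Splits) : F.Splits := by
  rw [taylor_apply] at h
  exact (splits_iff_comp_splits_of_natDegree_eq_one (natDegree_X_add_C c)).2 h

open Polynomial in
theorem exists_scale (f : (PowerSeries ℂ)[X]) (n : ℕ) (hf : f.Monic) (hn : f.natDegree = n + 1)
    (h1 : f.coeff n = 0) (i : ℕ) (hi : i < n + 1) (hi' : f.coeff i ≠ 0) :
    ∃ (q : ℕ) (hq : q ≠ 0) (p : ℕ) (g : (PowerSeries ℂ)[X]), g.Monic ∧ g.natDegree = n + 1 ∧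
      g.coeff n = 0 ∧ (∃ j < n + 1, PowerSeries.constantCoeff (g.coeff j) ≠ 0) ∧
      (f.map (PowerSeries.expand q hq : PowerSeries ℂ →ₐ[ℂ] PowerSeries ℂ).toRingHom).comp
        (C (PowerSeries.X ^ p) * X) = C (PowerSeries.X ^ (p * (n + 1))) * g := by
  obtain ⟨j, hj, hmin⟩ := Finset.exists_min_image
    ((Finset.range (n+1)).filter fun i => f.coeff i ≠ 0)
    (fun i => ((f.coeff i).order.toNat : ℚ) / ((n + 1 - i : ℕ) : ℚ)) ⟨i, by simp [hi, hi']⟩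
  simp only [Finset.mem_filter, Finset.mem_range] at hj hmin
  obtain ⟨hjn, hj0⟩ := hj
  set p := (f.coeff j).order.toNat with hp
  set q := n + 1 - j with hq
  have hq0 : q ≠ 0 := by omega
  have hdvd : ∀ i, ∃ b : PowerSeries ℂ, i < n + 1 →
      PowerSeries.expand q hq0 (f.coeff i) = PowerSeries.X ^ (p * (n + 1 - i)) * b := by
    intro i
    by_cases hi : i < n + 1
    swap
    · exact ⟨0, fun h => absurd h hi⟩
    suffices h : PowerSeries.X ^ (p * (n + 1 - i)) ∣ PowerSeries.expand q hq0 (f.coeff i) by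
      obtain ⟨b, hb⟩ := h
      exact ⟨b, fun _ => hb⟩
    rw [PowerSeries.X_pow_dvd_iff]
    intro m hm
    by_cases hd : q ∣ m
    swap
    · exact PowerSeries.coeff_expand_of_not_dvd _ _ _ hd
    obtain ⟨k, rfl⟩ := hd
    rw [PowerSeries.coeff_expand_mul]
    by_cases h0 : f.coeff i = 0
    · rw [h0]; simp
    apply PowerSeries.coeff_of_lt_order_toNat
    have h2 := hmin i ⟨hi, h0⟩
    rw [div_le_div_iff₀ (by exact_mod_cast Nat.pos_of_ne_zero hq0)
      (by exact_mod_cast (by omega : 0 < n + 1 - i))] at h2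
    have h3 : p * (n + 1 - i) ≤ (f.coeff i).order.toNat * q := by exact_mod_cast h2
    have h4 : q * k < q * (f.coeff i).order.toNat := by rw [mul_comm q (PowerSeries.order _).toNat]; omega
    exact Nat.lt_of_mul_lt_mul_left h4
  choose b hb using hdvd
  have hX : ∀ m, (PowerSeries.X : PowerSeries ℂ) ^ m ≠ 0 := fun m => pow_ne_zero _ PowerSeries.X_ne_zero
  have hfn : f.coeff (n + 1) = 1 := by rw [← hn]; exact hf
  set g : (PowerSeries ℂ)[X] := X ^ (n + 1) + ∑ i ∈ Finset.range (n + 1), C (b i) * X ^ i with hg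
  have hglt : (∑ i ∈ Finset.range (n + 1), C (b i) * X ^ i).degree < ((n + 1 : ℕ) : WithBot ℕ) := by
    apply degree_sum_fin_lt (n := n+1) (fun i : Fin (n+1) => b i) |> fun h => ?_
    rw [Finset.sum_range]; exact h
  have hgm : g.Monic := monic_X_pow_add hglt
  have hgd : g.natDegree = n + 1 := by
    rw [hg, natDegree_add_eq_left_of_degree_lt (by rw [degree_X_pow]; exact hglt), natDegree_X_pow]
  have hgc : ∀ i < n + 1, g.coeff i = b i := by
    intro i hi
    rw [hg, coeff_add, coeff_X_pow, if_neg hi.ne, zero_add, finsetSum_coeff]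
    simp [coeff_X_pow]
    omega
  refine ⟨q, hq0, p, g, hgm, hgd, ?_, ⟨j, hjn, ?_⟩, ?_⟩
  · rw [hgc n (by omega)]
    have := hb n (by omega)
    rw [h1, map_zero] at this
    exact (mul_eq_zero.1 this.symm).resolve_left (hX _)
  · rw [hgc j hjn]
    have := hb j hjn
    rw [← hq] at this
    have h2 := congrArg (PowerSeries.coeff (q * p)) this
    rw [PowerSeries.coeff_expand_mul, mul_comm q p, PowerSeries.coeff_X_pow_mul',
      if_pos le_rfl, Nat.sub_self, PowerSeries.coeff_zero_eq_constantCoeff_apply] at h2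
    rw [← h2]
    exact PowerSeries.coeff_order hj0
  · ext1 i
    rw [comp_C_mul_X_coeff, coeff_map, coeff_C_mul]
    rcases lt_trichotomy i (n+1) with hlt | rfl | hgt
    · rw [hgc i hlt]
      have := hb i hlt
      change PowerSeries.expand q hq0 (f.coeff i) * _ = _
      rw [this, mul_right_comm, ← pow_mul, ← pow_add, ← mul_add, Nat.sub_add_cancel hlt.le]
    · have : g.coeff (n+1) = 1 := by rw [← hgd]; exact hgm
      rw [hfn, this, map_one, ← pow_mul, mul_comm]
    · rw [coeff_eq_zero_of_natDegree_lt (by omega), coeff_eq_zero_of_natDegree_lt (p := g) (by omega)]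
      simp

open Polynomial in
theorem puiseux (n : ℕ) : ∀ (r : ℚ) (hr : 0 < r) (f : (PowerSeries ℂ)[X]), f.Monic →
    f.natDegree = n → (f.map (phi r hr)).Splits := by
  induction n using Nat.strong_induction_on with
  | _ n ih =>
  intro r hr f0 hf0 hn0
  rcases n with _ | n
  · exact Splits.of_natDegree_eq_zero (by rw [hf0.natDegree_map, hn0])
  -- remove the next coefficient
  obtain ⟨b, hb⟩ : ∃ b : PowerSeries ℂ, f0.coeff n + ((n : PowerSeries ℂ) + 1) * b = 0 := by
    refine ⟨- (PowerSeries.C ((n + 1 : ℂ)⁻¹) * f0.coeff n), ?_⟩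
    have h : ((n : PowerSeries ℂ) + 1) = PowerSeries.C (n + 1 : ℂ) := by simp
    have h2 : PowerSeries.C (n + 1 : ℂ) * PowerSeries.C ((n + 1 : ℂ)⁻¹) = 1 := by
      rw [← map_mul, mul_inv_cancel₀ (by exact_mod_cast (Nat.succ_ne_zero n)), map_one]
    rw [h, mul_neg, ← mul_assoc, h2, one_mul, add_neg_cancel]
  apply splits_of_taylor _ (phi r hr b)
  rw [← map_taylor]
  set f := taylor b f0 with hfdef
  have hf : f.Monic := by rw [Monic, hfdef, leadingCoeff_taylor]; exact hf0
  have hn : f.natDegree = n + 1 := by rw [hfdef, natDegree_taylor, hn0]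
  have h1 : f.coeff n = 0 := by rw [hfdef, taylor_coeff_pred f0 n hf0 hn0, hb]
  clear_value f
  by_cases hz : ∀ i < n + 1, f.coeff i = 0
  · have : f = X ^ (n + 1) := by
      ext1 i
      rw [coeff_X_pow]
      split_ifs with h
      · rw [h, ← hn]; exact hf
      · rcases lt_or_gt_of_ne h with h | h
        · exact hz i h
        · exact coeff_eq_zero_of_natDegree_lt (by omega)
    rw [this, Polynomial.map_pow, map_X]
    exact Splits.X_pow _
  push Not at hz
  obtain ⟨i, hi, hi'⟩ := hz
  obtain ⟨q, hq, p, g, hgm, hgd, hg1, ⟨j, hj, hj'⟩, hfg⟩ := exists_scale f n hf hn h1 i hi hi'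
  obtain ⟨c, u, v, hu, hv, huv, hud, hvd⟩ := exists_factor g n hgm hgd hg1 j hj hj'
  have hr' : 0 < r / q := div_pos hr (by exact_mod_cast Nat.pos_of_ne_zero hq)
  have hgs : (g.map (phi (r / q) hr')).Splits := by
    apply splits_of_taylor _ (phi (r / q) hr' c)
    rw [← map_taylor, huv, Polynomial.map_mul]
    exact (ih _ hud _ _ u hu rfl).mul (ih _ hvd _ _ v hv rfl)
  have hphi : phi r hr = (phi (r / q) hr').comp
      (PowerSeries.expand q hq : PowerSeries ℂ →ₐ[ℂ] PowerSeries ℂ).toRingHom := by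
    ext1 x
    exact phi_expand r hr q hq hr' x
  have hfg' := congrArg (Polynomial.map (phi (r / q) hr')) hfg
  rw [Polynomial.map_comp, Polynomial.map_map, ← hphi, Polynomial.map_mul, Polynomial.map_mul,
    map_C, map_C, map_X] at hfg'
  have ht0 : phi (r / q) hr' (PowerSeries.X ^ p) ≠ 0 := by
    rw [Ne, map_eq_zero_iff _ (phi_injective _ _)]
    exact pow_ne_zero _ PowerSeries.X_ne_zero
  refine (splits_iff_comp_splits_of_natDegree_eq_one (g := C (phi (r / q) hr' (PowerSeries.X ^ p)) * X)
    (natDegree_C_mul_X _ ht0)).2 ?_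
  rw [hfg']
  exact hgs.C_mul _
open Polynomial in
theorem splits_map_phi (r : ℚ) (hr : 0 < r) (f : (PowerSeries ℂ)[X]) : (f.map (phi r hr)).Splits := by
  by_cases hf : f = 0
  · rw [hf, Polynomial.map_zero]; exact Splits.zero
  have hs := puiseux _ r hr _ (monic_integralNormalization hf) rfl
  have h1 := congrArg (Polynomial.map (phi r hr)) (integralNormalization_mul_C_leadingCoeff f)
  rw [Polynomial.map_mul, map_C] at h1
  have ha : phi r hr f.leadingCoeff ≠ 0 := by
    rw [Ne, map_eq_zero_iff _ (phi_injective _ _)]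
    exact leadingCoeff_ne_zero.2 hf
  have hs2 := hs.mul (Splits.C (phi r hr f.leadingCoeff))
  rw [h1, splits_iff_comp_splits_of_natDegree_eq_one (natDegree_C_mul_X _ ha)] at hs2
  have h2 : ((f.scaleRoots f.leadingCoeff).map (phi r hr)).comp (C (phi r hr f.leadingCoeff) * X)
      = C (phi r hr f.leadingCoeff ^ f.natDegree) * f.map (phi r hr) := by
    ext1 i
    rw [comp_C_mul_X_coeff, coeff_map, coeff_C_mul, coeff_map, coeff_scaleRoots, map_mul, map_pow]
    by_cases hi : i ≤ f.natDegree
    · rw [mul_assoc, ← pow_add, Nat.sub_add_cancel hi, mul_comm]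
    · rw [coeff_eq_zero_of_natDegree_lt (by omega)]; simp
  rw [h2] at hs2
  have := hs2.C_mul (phi r hr f.leadingCoeff ^ f.natDegree)⁻¹
  rwa [← mul_assoc, ← C_mul, inv_mul_cancel₀ (pow_ne_zero _ ha), C_1, one_mul] at this

theorem phi_monomial (r : ℚ) (hr : 0 < r) (n : ℕ) (c : ℂ) :
    phi r hr (PowerSeries.monomial n c) = HahnSeries.single (OrderDual.toDual (-(r * n))) c := by
  ext e
  induction e using OrderDual.rec with | _ e
  by_cases h : ∃ m : ℕ, e = -(r * m)
  · obtain ⟨m, rfl⟩ := h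
    rw [phi_coeff, PowerSeries.coeff_monomial, HahnSeries.coeff_single]
    have : (m = n) ↔ (OrderDual.toDual (-(r * (m:ℚ))) = OrderDual.toDual (-(r * (n:ℚ)))) := by
      rw [OrderDual.toDual_inj, neg_inj, mul_right_inj' hr.ne', Nat.cast_inj]
    simp only [this]
    congr
  · push Not at h
    rw [phi_coeff' _ _ _ _ h, HahnSeries.coeff_single_of_ne]
    exact fun h' => h n (OrderDual.toDual.injective h')

open Polynomial in
theorem polyY_splits (h : MvPolynomial (Fin 2) ℂ) : (polyY h).Splits := by
  set M := (supp h).sup Prod.fst with hM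
  set f : (PowerSeries ℂ)[X] := ∑ p ∈ supp h, C (PowerSeries.monomial (M - p.1) (coeff2 h p)) * X ^ p.2
    with hf
  have hs := (splits_map_phi 1 one_pos f).C_mul (HahnSeries.single (OrderDual.toDual (M : ℚ)) 1 : K)
  have he : C (HahnSeries.single (OrderDual.toDual (M : ℚ)) 1 : K) * f.map (phi 1 one_pos) = polyY h := by
    rw [hf, Polynomial.map_sum, Finset.mul_sum, polyY]
    refine Finset.sum_congr rfl fun p hp => ?_
    rw [Polynomial.map_mul, Polynomial.map_pow, map_X, map_C, phi_monomial, ← mul_assoc, ← C_mul,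
      HahnSeries.single_mul_single, one_mul, ← toDual_add]
    have : p.1 ≤ M := Finset.le_sup (f := Prod.fst) hp
    congr 5
    · push_cast [this]
      ring
    · exact one_mul _
  rwa [he] at hs

/-- `x` has degree at most `w`, and its coefficient at `w` is `c`. -/
def IsIn (x : K) (w : ℚ) (c : ℂ) : Prop :=
  (∀ e > w, x.coeff (OrderDual.toDual e) = 0) ∧ x.coeff (OrderDual.toDual w) = c

theorem IsIn.mul {x y : K} {w w' : ℚ} {c c' : ℂ} (hx : IsIn x w c) (hy : IsIn y w' c') :
    IsIn (x * y) (w + w') (c * c') := by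
  have hle : ∀ {x : K} {w c}, IsIn x w c → ∀ e : ℚᵒᵈ, e ∈ x.support → OrderDual.ofDual e ≤ w := by
    intro x w c hx e he
    by_contra hlt
    push Not at hlt
    exact he (hx.1 _ hlt)
  constructor
  · intro e he
    rw [HahnSeries.coeff_mul]
    apply Finset.sum_eq_zero
    intro ij hij
    rw [Finset.mem_antidiagonal] at hij
    have h1 := hle hx _ hij.1
    have h2 := hle hy _ hij.2.1
    have h3 : OrderDual.ofDual ij.1 + OrderDual.ofDual ij.2 = e := congrArg OrderDual.ofDual hij.2.2
    linarith
  · rw [HahnSeries.coeff_mul, Finset.sum_eq_single (OrderDual.toDual w, OrderDual.toDual w')]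
    · rw [hx.2, hy.2]
    · intro ij hij hne
      rw [Finset.mem_antidiagonal] at hij
      have h1 := hle hx _ hij.1
      have h2 := hle hy _ hij.2.1
      have h3 : OrderDual.ofDual ij.1 + OrderDual.ofDual ij.2 = w + w' := congrArg OrderDual.ofDual hij.2.2
      exfalso
      apply hne
      have h4 : OrderDual.ofDual ij.1 = w := by linarith
      have h5 : OrderDual.ofDual ij.2 = w' := by linarith
      exact Prod.ext h4 h5
    · intro hn
      rw [Finset.mem_antidiagonal] at hn
      by_contra hne
      apply hn
      exact ⟨left_ne_zero_of_mul hne, right_ne_zero_of_mul hne, rfl⟩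

theorem IsIn.zero (w : ℚ) : IsIn 0 w 0 := ⟨fun _ _ => rfl, rfl⟩

theorem IsIn.add {x y : K} {w : ℚ} {c c' : ℂ} (hx : IsIn x w c) (hy : IsIn y w c') :
    IsIn (x + y) w (c + c') :=
  ⟨fun e he => by rw [HahnSeries.coeff_add, hx.1 e he, hy.1 e he, add_zero],
   by rw [HahnSeries.coeff_add, hx.2, hy.2]⟩

theorem IsIn.neg {x : K} {w : ℚ} {c : ℂ} (hx : IsIn x w c) : IsIn (-x) w (-c) :=
  ⟨fun e he => by rw [HahnSeries.coeff_neg, hx.1 e he, neg_zero],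
   by rw [HahnSeries.coeff_neg, hx.2]⟩

theorem IsIn.sum {ι : Type*} (s : Finset ι) {x : ι → K} {w : ℚ} {c : ι → ℂ}
    (hx : ∀ i ∈ s, IsIn (x i) w (c i)) : IsIn (∑ i ∈ s, x i) w (∑ i ∈ s, c i) := by
  induction s using Finset.induction_on with
  | empty => simpa using IsIn.zero w
  | insert a s ha ih =>
    rw [Finset.sum_insert ha, Finset.sum_insert ha]
    exact (hx a (Finset.mem_insert_self _ _)).add (ih fun i hi => hx i (Finset.mem_insert_of_mem hi))

theorem IsIn.single_self (w : ℚ) (c : ℂ) : IsIn (HahnSeries.single (OrderDual.toDual w) c) w c :=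
  ⟨fun e he => HahnSeries.coeff_single_of_ne (fun h => he.ne' (OrderDual.toDual.injective h)),
   HahnSeries.coeff_single_same _ _⟩

theorem IsIn.of_lt {x : K} {w w' : ℚ} {c : ℂ} (hx : IsIn x w c) (h : w < w') : IsIn x w' 0 :=
  ⟨fun e he => hx.1 e (h.trans he), hx.1 _ h⟩

theorem IsIn.self (x : K) : IsIn x (degLP x) x.leadingCoeff := by
  refine ⟨fun e he => ?_, ?_⟩
  · apply HahnSeries.coeff_eq_zero_of_lt_order
    exact he
  · exact HahnSeries.leadingCoeff_eq.symm

open Polynomial in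
def IsInP (f : K[X]) (w : ℚ) (g : ℂ[X]) : Prop := ∀ i, IsIn (f.coeff i) w (g.coeff i)

open Polynomial in
theorem IsInP.mul {f f' : K[X]} {w w' : ℚ} {g g' : ℂ[X]} (h : IsInP f w g) (h' : IsInP f' w' g') :
    IsInP (f * f') (w + w') (g * g') := by
  intro i
  rw [coeff_mul, coeff_mul]
  exact IsIn.sum _ fun p _ => (h _).mul (h' _)

open Polynomial in
theorem IsInP.add {f f' : K[X]} {w : ℚ} {g g' : ℂ[X]} (h : IsInP f w g) (h' : IsInP f' w g') :
    IsInP (f + f') w (g + g') := by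
  intro i
  rw [coeff_add, coeff_add]
  exact (h i).add (h' i)

theorem IsIn.sub {x y : K} {w : ℚ} {c c' : ℂ} (hx : IsIn x w c) (hy : IsIn y w c') :
    IsIn (x - y) w (c - c') := by
  rw [sub_eq_add_neg, sub_eq_add_neg]
  exact hx.add hy.neg

open Polynomial in
theorem IsInP.sub {f f' : K[X]} {w : ℚ} {g g' : ℂ[X]} (h : IsInP f w g) (h' : IsInP f' w g') :
    IsInP (f - f') w (g - g') := by
  intro i
  rw [coeff_sub, coeff_sub]
  exact (h i).sub (h' i)

open Polynomial in
theorem IsInP.sum {ι : Type*} (s : Finset ι) {f : ι → K[X]} {w : ℚ} {g : ι → ℂ[X]}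
    (hx : ∀ i ∈ s, IsInP (f i) w (g i)) : IsInP (∑ i ∈ s, f i) w (∑ i ∈ s, g i) := by
  intro i
  rw [finsetSum_coeff, finsetSum_coeff]
  exact IsIn.sum _ fun p hp => hx p hp i

open Polynomial in
theorem IsInP.C_mul_X_pow {x : K} {w : ℚ} {c : ℂ} (h : IsIn x w c) (k : ℕ) :
    IsInP (C x * X ^ k) w (C c * X ^ k) := by
  intro i
  rw [coeff_C_mul_X_pow, coeff_C_mul_X_pow]
  split_ifs
  · exact h
  · exact IsIn.zero w

open Polynomial in
theorem IsInP.C {x : K} {w : ℚ} {c : ℂ} (h : IsIn x w c) : IsInP (C x) w (C c) := by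
  simpa using IsInP.C_mul_X_pow h 0

open Polynomial in
theorem IsInP.unique {f : K[X]} {w w' : ℚ} {g g' : ℂ[X]} (h : IsInP f w g) (h' : IsInP f w' g')
    (hg : g ≠ 0) (hg' : g' ≠ 0) : g = g' := by
  have aux : ∀ {w w' : ℚ} {g g' : ℂ[X]}, IsInP f w g → IsInP f w' g' → w < w' → g' = 0 := by
    intro w w' g g' h h' hlt
    ext i
    rw [← (h' i).2, (h i).1 _ hlt, coeff_zero]
  rcases lt_trichotomy w w' with hlt | rfl | hlt
  · exact absurd (aux h h' hlt) hg'
  · ext i; rw [← (h i).2, (h' i).2]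
  · exact absurd (aux h' h hlt) hg

open Polynomial in
/-- initial form of a product of linear factors -/
theorem isInP_prod (θ : ℚ) (s : Multiset K) : ∃ (W : ℚ) (g : ℂ[X]), g ≠ 0 ∧
    IsInP (s.map fun a => C (XpowQ θ) * X - C a).prod W g ∧
    g.roots.filter (fun c => c ≠ 0) =
      (s.filter fun a : K => a ≠ 0 ∧ a.order = OrderDual.toDual θ).map HahnSeries.leadingCoeff := by
  induction s using Multiset.induction_on with
  | empty =>
    refine ⟨0, 1, one_ne_zero, ?_, by simp⟩
    have : IsIn (1 : K) 0 1 := IsIn.single_self 0 1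
    simpa using IsInP.C this
  | cons a s ih =>
    obtain ⟨W, g, hg0, hg, hr⟩ := ih
    have hX : ∀ {w : ℚ} {c d : ℂ}, IsIn (XpowQ θ) w c → IsIn a w d →
        IsInP (C (XpowQ θ) * X - C a) w (C c * X - C d) := by
      intro w c d h1 h2
      have := (IsInP.C_mul_X_pow h1 1).sub (IsInP.C h2)
      rw [pow_one, pow_one] at this
      exact this
    have hx : IsIn (XpowQ θ) θ 1 := IsIn.single_self θ 1
    suffices H : ∃ (W : ℚ) (u : ℂ[X]), u ≠ 0 ∧ IsInP (C (XpowQ θ) * X - C a) W u ∧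
        u.roots.filter (fun c => c ≠ 0) = (({a} : Multiset K).filter
          fun a : K => a ≠ 0 ∧ a.order = OrderDual.toDual θ).map HahnSeries.leadingCoeff by
      obtain ⟨W', u, hu0, hu, hur⟩ := H
      refine ⟨W' + W, u * g, mul_ne_zero hu0 hg0, ?_, ?_⟩
      · rw [Multiset.map_cons, Multiset.prod_cons]
        exact hu.mul hg
      · rw [roots_mul (mul_ne_zero hu0 hg0), Multiset.filter_add, hr, hur, ← Multiset.singleton_add,
          Multiset.filter_add, Multiset.map_add]
    by_cases ha : a = 0
    · refine ⟨θ, X, X_ne_zero, ?_, by simp [ha, Multiset.filter_singleton]⟩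
      have := hX hx (ha ▸ IsIn.zero θ)
      simpa using this
    have hal : a.leadingCoeff ≠ 0 := HahnSeries.leadingCoeff_ne_zero.2 ha
    rcases lt_trichotomy (degLP a) θ with hlt | heq | hgt
    · refine ⟨θ, X, X_ne_zero, ?_, ?_⟩
      · simpa using hX hx ((IsIn.self a).of_lt hlt)
      · have : ¬ a.order = OrderDual.toDual θ := fun h => hlt.ne (congrArg OrderDual.ofDual h)
        simp [Multiset.filter_singleton, this]
    · refine ⟨θ, X - C a.leadingCoeff, X_sub_C_ne_zero _, ?_, ?_⟩
      · simpa using hX hx (heq ▸ IsIn.self a)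
      · have : a.order = OrderDual.toDual θ := congrArg OrderDual.toDual heq
        simp [Multiset.filter_singleton, this, ha]
    · refine ⟨degLP a, C (-a.leadingCoeff), by simpa using ha, ?_, ?_⟩
      · simpa using hX (hx.of_lt hgt) (IsIn.self a)
      · have : ¬ a.order = OrderDual.toDual θ := fun h => hgt.ne' (congrArg OrderDual.ofDual h)
        simp [Multiset.filter_singleton, this, -map_neg]
theorem coeff2_ne_zero (h : MvPolynomial (Fin 2) ℂ) (p : ℕ × ℕ) (hp : p ∈ supp h) :
    coeff2 h p ≠ 0 := by
  rw [supp, Finset.mem_image] at hp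
  obtain ⟨d, hd, rfl⟩ := hp
  have : (Finsupp.single 0 (d 0) + Finsupp.single 1 (d 1) : Fin 2 →₀ ℕ) = d := by
    ext i; fin_cases i <;> simp
  rw [coeff2, this]
  exact MvPolynomial.mem_support_iff.1 hd

theorem decl_mul (S : Seg) (hlt : S.P.2 < S.Q.2) :
    ((S.Q.2 : ℚ) - S.P.2) * decl S = -((S.Q.1 : ℚ) - S.P.1) := by
  have hD : (0 : ℚ) < (S.Q.2 : ℚ) - S.P.2 := by
    rw [sub_pos]; exact_mod_cast hlt
  rw [decl, len1, len2, abs_of_pos hD, sigmaR]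
  split_ifs with h1 h2
  · rw [h1]; simp
  · have : (0 : ℚ) < (S.Q.1 : ℚ) - S.P.1 := by rw [sub_pos]; exact_mod_cast h2
    rw [abs_of_pos this]; field_simp; push_cast; ring
  · have : (S.Q.1 : ℚ) - S.P.1 ≤ 0 := by rw [sub_nonpos]; exact_mod_cast (not_lt.1 h2)
    rw [abs_of_nonpos this]; field_simp; push_cast; ring

theorem lfun_cast (S : Seg) (hlt : S.P.2 < S.Q.2) (v : ℕ × ℕ) :
    (lfun S v : ℚ) = ((S.Q.2 : ℚ) - S.P.2) * (v.1 + decl S * v.2) := by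
  rw [mul_add, ← mul_assoc, decl_mul S hlt, lfun]
  push_cast; ring

theorem onSeg_iff (h : MvPolynomial (Fin 2) ℂ) (S : Seg) (hS : RightSeg h S) (v : ℕ × ℕ)
    (hv : v ∈ supp h) : OnSeg S v ↔ (v.1 : ℚ) + decl S * v.2 = S.P.1 + decl S * S.P.2 := by
  obtain ⟨hP, hQ, hlt, hle, hbox⟩ := hS
  have hD : (0 : ℚ) < (S.Q.2 : ℚ) - S.P.2 := by
    rw [sub_pos]; exact_mod_cast hlt
  have hiff : lfun S v = lfun S S.P ↔ (v.1 : ℚ) + decl S * v.2 = S.P.1 + decl S * S.P.2 := by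
    rw [← Int.cast_inj (α := ℚ), lfun_cast S hlt, lfun_cast S hlt, mul_right_inj' hD.ne']
  rw [← hiff]
  refine ⟨fun h => h.1, fun h => ?_⟩
  obtain ⟨hb1, hb2⟩ := hbox v hv h
  rw [OnSeg, min_eq_left hlt.le, max_eq_right hlt.le]
  rw [lfun, lfun] at h
  have hlt' : (0:ℤ) < (S.Q.2 : ℤ) - S.P.2 := by omega
  have hb1' : (0:ℤ) ≤ (v.2 : ℤ) - S.P.2 := by omega
  have hb2' : (0:ℤ) ≤ (S.Q.2 : ℤ) - v.2 := by omega
  refine ⟨by rw [lfun, lfun]; exact h, ?_, ?_, hb1, hb2⟩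
  · rcases le_total S.P.1 S.Q.1 with hc | hc
    · rw [min_eq_left hc]
      have hc' : (0:ℤ) ≤ (S.Q.1 : ℤ) - S.P.1 := by omega
      by_contra hcon
      have : (0:ℤ) < (S.P.1 : ℤ) - v.1 := by omega
      nlinarith [mul_pos hlt' this, mul_nonneg hc' hb1']
    · rw [min_eq_right hc]
      have hc' : (0:ℤ) ≤ (S.P.1 : ℤ) - S.Q.1 := by omega
      by_contra hcon
      have : (0:ℤ) < (S.Q.1 : ℤ) - v.1 := by omega
      nlinarith [mul_pos hlt' this, mul_nonneg hc' hb2']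
  · rcases le_total S.P.1 S.Q.1 with hc | hc
    · rw [max_eq_right hc]
      have hc' : (0:ℤ) ≤ (S.Q.1 : ℤ) - S.P.1 := by omega
      by_contra hcon
      have : (0:ℤ) < (v.1 : ℤ) - S.Q.1 := by omega
      nlinarith [mul_pos hlt' this, mul_nonneg hc' hb2']
    · rw [max_eq_left hc]
      have hc' : (0:ℤ) ≤ (S.P.1 : ℤ) - S.Q.1 := by omega
      by_contra hcon
      have : (0:ℤ) < (v.1 : ℤ) - S.P.1 := by omega
      nlinarith [mul_pos hlt' this, mul_nonneg hc' hb1']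

open Polynomial in
/-- the initial form as a one-variable polynomial -/
def inOne (h : MvPolynomial (Fin 2) ℂ) (S : Seg) : ℂ[X] :=
  ∑ p ∈ (supp h).filter (OnSeg S), C (coeff2 h p) * X ^ p.2

theorem single_mul_XpowQ_pow (a : ℚ) (c : ℂ) (θ : ℚ) (k : ℕ) :
    (HahnSeries.single (OrderDual.toDual a) c : K) * XpowQ θ ^ k =
      HahnSeries.single (OrderDual.toDual (a + θ * k)) c := by
  rw [XpowQ, HahnSeries.single_pow, HahnSeries.single_mul_single, one_pow, mul_one]
  have : (OrderDual.toDual a + k • OrderDual.toDual θ : ℚᵒᵈ) = OrderDual.toDual (a + θ * k) := by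
    change OrderDual.toDual (a + k • θ) = _
    rw [nsmul_eq_mul, mul_comm]
  rw [this]

open Polynomial in
theorem comp_scale (s : Finset (ℕ × ℕ)) (c : ℕ × ℕ → ℂ) (θ : ℚ) :
    (∑ p ∈ s, C (HahnSeries.single (OrderDual.toDual (p.1 : ℚ)) (c p) : K) * X ^ p.2).comp
      (C (XpowQ θ) * X) =
    ∑ p ∈ s, C (HahnSeries.single (OrderDual.toDual ((p.1 : ℚ) + θ * p.2)) (c p) : K) * X ^ p.2 := by
  rw [Polynomial.sum_comp]
  refine Finset.sum_congr rfl fun p _ => ?_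
  rw [mul_comp, C_comp, X_pow_comp, mul_pow, ← C_pow, ← mul_assoc, ← C_mul, single_mul_XpowQ_pow]

open Polynomial in
theorem isInP_polyY (h : MvPolynomial (Fin 2) ℂ) (S : Seg) (hS : RightSeg h S) :
    IsInP ((polyY h).comp (C (XpowQ (decl S)) * X)) (S.P.1 + decl S * S.P.2) (inOne h S) := by
  rw [polyY, comp_scale, inOne, Finset.sum_filter]
  apply IsInP.sum
  intro p hp
  have hle : (p.1 : ℚ) + decl S * p.2 ≤ S.P.1 + decl S * S.P.2 := by
    have h1 := hS.2.2.2.1 p hp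
    have hlt := hS.2.2.1
    have hD : (0 : ℚ) < (S.Q.2 : ℚ) - S.P.2 := by
      rw [sub_pos]; exact_mod_cast hlt
    rw [← Int.cast_le (R := ℚ), lfun_cast S hlt, lfun_cast S hlt] at h1
    exact le_of_mul_le_mul_left h1 hD
  have hiff := onSeg_iff h S hS p hp
  split_ifs with hon
  · rw [hiff.1 hon]
    exact IsInP.C_mul_X_pow (IsIn.single_self _ _) _
  · have hlt := lt_of_le_of_ne hle (fun he => hon (hiff.2 he))
    simpa using IsInP.C_mul_X_pow ((IsIn.single_self _ (coeff2 h p)).of_lt hlt) p.2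

open Polynomial in
theorem inPolyY_comp (h : MvPolynomial (Fin 2) ℂ) (S : Seg) (hS : RightSeg h S) :
    (inPolyY h S).comp (C (XpowQ (decl S)) * X) =
      C (XpowQ (S.P.1 + decl S * S.P.2)) * (inOne h S).map (HahnSeries.C : ℂ →+* K) := by
  rw [inPolyY, comp_scale, inOne, Polynomial.map_sum, Finset.mul_sum]
  refine Finset.sum_congr rfl fun p hp => ?_
  rw [Finset.mem_filter] at hp
  rw [(onSeg_iff h S hS p hp.1).1 hp.2, Polynomial.map_mul, Polynomial.map_pow, map_X, map_C,
    ← mul_assoc, ← C_mul, HahnSeries.C_apply, XpowQ, HahnSeries.single_mul_single, add_zero, one_mul]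

open Polynomial in
theorem inOne_coeff (h : MvPolynomial (Fin 2) ℂ) (S : Seg) (hS : RightSeg h S) (v : ℕ × ℕ)
    (hv : v ∈ supp h) (hon : OnSeg S v) : (inOne h S).coeff v.2 = coeff2 h v := by
  rw [inOne, finsetSum_coeff, Finset.sum_eq_single v]
  · simp
  · intro p hp hne
    rw [coeff_C_mul_X_pow, if_neg]
    intro he
    apply hne
    rw [Finset.mem_filter] at hp
    have h1 := (onSeg_iff h S hS p hp.1).1 hp.2
    have h2 := (onSeg_iff h S hS v hv).1 hon
    rw [← h2, ← he] at h1
    have h3 : (p.1 : ℚ) = v.1 := by linarith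
    exact Prod.ext (by exact_mod_cast h3) he.symm
  · intro hn
    exact absurd (Finset.mem_filter.2 ⟨hv, hon⟩) hn

open Polynomial in
theorem inOne_coeff_zero (h : MvPolynomial (Fin 2) ℂ) (S : Seg) (hS : RightSeg h S) (i : ℕ)
    (hi : i < S.P.2 ∨ S.Q.2 < i) : (inOne h S).coeff i = 0 := by
  rw [inOne, finsetSum_coeff]
  apply Finset.sum_eq_zero
  intro p hp
  rw [Finset.mem_filter] at hp
  have := hS.2.2.2.2 p hp.1 hp.2.1
  rw [coeff_C_mul_X_pow, if_neg]
  omega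

open Polynomial in
theorem inOne_facts (h : MvPolynomial (Fin 2) ℂ) (S : Seg) (hS : RightSeg h S) :
    inOne h S ≠ 0 ∧ (inOne h S).natDegree = S.Q.2 ∧ (inOne h S).rootMultiplicity 0 = S.P.2 := by
  have hlt := hS.2.2.1
  have hPon : OnSeg S S.P := (onSeg_iff h S hS _ hS.1).2 rfl
  have hQon : OnSeg S S.Q := (onSeg_iff h S hS _ hS.2.1).2 (by
    have := decl_mul S hlt
    linarith)
  have hP : (inOne h S).coeff S.P.2 ≠ 0 := by
    rw [inOne_coeff h S hS _ hS.1 hPon]; exact coeff2_ne_zero h _ hS.1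
  have hQ : (inOne h S).coeff S.Q.2 ≠ 0 := by
    rw [inOne_coeff h S hS _ hS.2.1 hQon]; exact coeff2_ne_zero h _ hS.2.1
  have h0 : inOne h S ≠ 0 := by
    intro h; rw [h] at hP; simp at hP
  refine ⟨h0, ?_, ?_⟩
  · apply le_antisymm _ (le_natDegree_of_ne_zero hQ)
    rw [natDegree_le_iff_coeff_eq_zero]
    intro i hi
    exact inOne_coeff_zero h S hS i (Or.inr hi)
  · rw [rootMultiplicity_eq_natTrailingDegree']
    apply le_antisymm (natTrailingDegree_le_of_ne_zero hP)
    apply le_natTrailingDegree h0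
    intro i hi
    exact inOne_coeff_zero h S hS i (Or.inl hi)

theorem XpowQ_ne_zero (θ : ℚ) : XpowQ θ ≠ 0 := HahnSeries.single_ne_zero one_ne_zero

open Polynomial in
theorem roots_relation (h : MvPolynomial (Fin 2) ℂ) (S : Seg) (hS : RightSeg h S) :
    (inOne h S).roots.filter (fun c => c ≠ 0) =
      ((polyY h).roots.filter fun a : K => a ≠ 0 ∧ a.order = OrderDual.toDual (decl S)).map
        HahnSeries.leadingCoeff := by
  obtain ⟨W, g, hg0, hg, hr⟩ := isInP_prod (decl S) (polyY h).roots
  have h1 := isInP_polyY h S hS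
  have h0 := (inOne_facts h S hS).1
  have hF : (polyY h) ≠ 0 := by
    intro hF
    apply h0
    rw [hF, zero_comp] at h1
    ext i
    rw [← (h1 i).2]; rfl
  have hfac : (polyY h).comp (C (XpowQ (decl S)) * X) = C (polyY h).leadingCoeff *
      ((polyY h).roots.map fun a => C (XpowQ (decl S)) * X - C a).prod := by
    conv_lhs => rw [(polyY_splits h).eq_prod_roots]
    rw [mul_comp, C_comp, multiset_prod_comp, Multiset.map_map]
    congr 2
    refine Multiset.map_congr rfl fun a _ => ?_
    simp
  have hl : (polyY h).leadingCoeff.leadingCoeff ≠ 0 :=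
    HahnSeries.leadingCoeff_ne_zero.2 (leadingCoeff_ne_zero.2 hF)
  have h2 := (IsInP.C (IsIn.self (polyY h).leadingCoeff)).mul hg
  rw [← hfac] at h2
  have h3 := h1.unique h2 h0 (mul_ne_zero (C_ne_zero.2 hl) hg0)
  rw [h3, roots_C_mul _ hl, hr]

/-- Theorem 6.3(b): for `h ≠ 0` and a segment `S` of the right Newton polygon of `h`,
the equation `h(X,Y) = 0` has, counting multiplicities, exactly `|S₂|` non-zero
Laurent–Puiseux solutions of degree `(|S₁|/|S₂|)·σ(S)`; moreover if `(Y − cX^θ)` occurs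
with multiplicity exactly `k` in `in(h,S)` (with `θ` the declivity and `c ≠ 0`), then
exactly `k` of these solutions, with multiplicity, have leading term `cX^θ`. -/
theorem stmt14 (h : MvPolynomial (Fin 2) ℂ) (h0 : h ≠ 0) (S : Seg) (hS : RightSeg h S) :
    (((polyY h).roots.filter fun a : K => a ≠ 0 ∧ degLP a = decl S).card
        = S.Q.2 - S.P.2) ∧
    ∀ (c : ℂ), c ≠ 0 → ∀ k : ℕ,
      (inPolyY h S).rootMultiplicity
          (HahnSeries.single (OrderDual.toDual (decl S)) c) = k →
      ((polyY h).roots.filter fun a : K =>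
          a ≠ 0 ∧ a.order = OrderDual.toDual (decl S) ∧ a.leadingCoeff = c).card = k := by
  have hrel := roots_relation h S hS
  obtain ⟨hne, hdeg, htr⟩ := inOne_facts h S hS
  constructor
  · have h1 := congrArg Multiset.card hrel
    rw [Multiset.card_map] at h1
    have h2 : ((polyY h).roots.filter fun a : K => a ≠ 0 ∧ degLP a = decl S) =
        (polyY h).roots.filter fun a : K => a ≠ 0 ∧ a.order = OrderDual.toDual (decl S) := by
      refine Multiset.filter_congr fun a _ => ?_
      exact Iff.rfl
    rw [h2, ← h1]
    have h3 : (inOne h S).roots.card = S.Q.2 := by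
      rw [← hdeg]
      exact (IsAlgClosed.splits _).natDegree_eq_card_roots.symm
    have h4 : (inOne h S).roots.count 0 = S.P.2 := by
      rw [Polynomial.count_roots, htr]
    have h5 := congrArg Multiset.card (Multiset.filter_add_not (fun c : ℂ => c = 0) (inOne h S).roots)
    rw [Multiset.card_add, Multiset.filter_eq', Multiset.card_replicate, h3, h4] at h5
    change _ + Multiset.card (Multiset.filter (fun c : ℂ => c ≠ 0) (inOne h S).roots) = _ at h5
    omega
  · rintro c hc k rfl
    have h1 := congrArg (Multiset.count c) hrel
    rw [Multiset.count_filter_of_pos (p := fun c : ℂ => c ≠ 0) hc, Polynomial.count_roots, Multiset.count_map,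
      Multiset.filter_filter] at h1
    have h2 : ((polyY h).roots.filter fun a : K =>
          a ≠ 0 ∧ a.order = OrderDual.toDual (decl S) ∧ a.leadingCoeff = c) =
        (polyY h).roots.filter fun a : K => c = a.leadingCoeff ∧
          (a ≠ 0 ∧ a.order = OrderDual.toDual (decl S)) := by
      refine Multiset.filter_congr fun a _ => ?_
      constructor
      · rintro ⟨h1, h2, h3⟩; exact ⟨h3.symm, h1, h2⟩
      · rintro ⟨h3, h1, h2⟩; exact ⟨h1, h2, h3.symm⟩
    rw [h2, ← h1]
    have h3 := Polynomial.rootMultiplicity_comp_C_mul_X_add_C (inPolyY h S) (XpowQ (decl S)) 0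
      (HahnSeries.C c) (XpowQ_ne_zero _).isUnit
    have h4 : XpowQ (decl S) * HahnSeries.C c = HahnSeries.single (OrderDual.toDual (decl S)) c := by
      rw [HahnSeries.C_apply, XpowQ, HahnSeries.single_mul_single, add_zero, one_mul]
    rw [Polynomial.C_0, add_zero, add_zero, inPolyY_comp h S hS, h4] at h3
    rw [← h3, ← Polynomial.count_roots, ← Polynomial.count_roots,
      Polynomial.roots_C_mul _ (XpowQ_ne_zero _), Polynomial.count_roots, Polynomial.count_roots,
      ← Polynomial.eq_rootMultiplicity_map HahnSeries.C_injective]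
end
end

section
/- Let h ∈ ℂ[X,Y] be a polynomial without constant term, with ∂h/∂X ≠ 0 and ∂h/∂Y ≠ 0, not divisible by X² and not divisible by Y². Suppose at least one of the right or top Newton polygons of h has a non-exceptional segment. Then ℓ_∞(grad h) ≤ min{ inf_{S'} α(S'), inf_{S''} β(S'') } − 1, where S' runs over the non-exceptional segments of the right polygon, S'' over the non-exceptional segments of the top polygon, α(S) is the abscissa of the intersection of the line through S with the horizontal axis, and β(S) the ordinate of the intersection of the line through S with the vertical axis (each infimum is +∞ over an empty set). Moreover, if h is nondegenerate at infinity then equality holds. -/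
open scoped Classical

noncomputable section

/-- the norm `|z| = max{|x|,|y|}` on `ℂ²`. -/
def pnorm (z : ℂ × ℂ) : ℝ := max ‖z.1‖ ‖z.2‖

/-- the set of Łojasiewicz exponents of `H` at infinity. -/
def lojaSet (H : ℂ × ℂ → ℂ × ℂ) : Set ℝ :=
  {l | ∃ c : ℝ, 0 < c ∧ ∃ R : ℝ, ∀ z : ℂ × ℂ, R ≤ pnorm z → c * pnorm z ^ l ≤ pnorm (H z)}

/-- the Łojasiewicz exponent `ℓ_∞(H)` as an extended real (`sSup ∅ = −∞`). -/
def loja (H : ℂ × ℂ → ℂ × ℂ) : EReal :=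
  sSup ((fun l : ℝ => (l : EReal)) '' lojaSet H)

/-- the gradient mapping of `h`. -/
def gradMap (h : MvPolynomial (Fin 2) ℂ) : ℂ × ℂ → ℂ × ℂ :=
  fun z => (MvPolynomial.eval ![z.1, z.2] (MvPolynomial.pderiv (0 : Fin 2) h),
            MvPolynomial.eval ![z.1, z.2] (MvPolynomial.pderiv (1 : Fin 2) h))

/-- `h` is nondegenerate on the segment `S`: the system
`∂/∂X in(h,S) = ∂/∂Y in(h,S) = 0` has no solutions in `(ℂ∖{0}) × (ℂ∖{0})`. -/
def Nondeg (h : MvPolynomial (Fin 2) ℂ) (S : Seg) : Prop :=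
  ¬ ∃ x y : ℂ, x ≠ 0 ∧ y ≠ 0 ∧
    MvPolynomial.eval ![x, y] (MvPolynomial.pderiv (0 : Fin 2) (inPoly h S)) = 0 ∧
    MvPolynomial.eval ![x, y] (MvPolynomial.pderiv (1 : Fin 2) (inPoly h S)) = 0


/-! ### Abstract gradient sums -/

/-- `∂/∂X` of `∑ c_v X^{v₁} Y^{v₂}`. -/
def G0 (F : Finset (ℕ × ℕ)) (c : ℕ × ℕ → ℂ) (x y : ℂ) : ℂ :=
  ∑ v ∈ F, c v * v.1 * x ^ (v.1 - 1) * y ^ v.2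

/-- `∂/∂Y` of `∑ c_v X^{v₁} Y^{v₂}`. -/
def G1 (F : Finset (ℕ × ℕ)) (c : ℕ × ℕ → ℂ) (x y : ℂ) : ℂ :=
  ∑ v ∈ F, c v * v.2 * x ^ v.1 * y ^ (v.2 - 1)

/-- the right-segment predicate for a finite set. -/
def RS (F : Finset (ℕ × ℕ)) (S : Seg) : Prop :=
  S.P ∈ F ∧ S.Q ∈ F ∧ S.P.2 < S.Q.2 ∧
  (∀ v ∈ F, lfun S v ≤ lfun S S.P) ∧
  (∀ v ∈ F, lfun S v = lfun S S.P → S.P.2 ≤ v.2 ∧ v.2 ≤ S.Q.2)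

/-- coordinate swap on segments. -/
def Seg.sw (S : Seg) : Seg := ⟨S.P.swap, S.Q.swap⟩

/-- coordinate swap on finite sets. -/
def swF (F : Finset (ℕ × ℕ)) : Finset (ℕ × ℕ) := F.image Prod.swap

/-- coordinate swap on coefficients. -/
def swc (c : ℕ × ℕ → ℂ) : ℕ × ℕ → ℂ := fun v => c v.swap

lemma mem_swF {F : Finset (ℕ × ℕ)} {v : ℕ × ℕ} : v ∈ swF F ↔ v.swap ∈ F := by
  unfold swF
  rw [Finset.mem_image]
  constructor
  · rintro ⟨a, ha, rfl⟩; simpa using ha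
  · intro hv; exact ⟨v.swap, hv, by simp⟩

lemma swF_swF (F : Finset (ℕ × ℕ)) : swF (swF F) = F := by
  ext v; simp [mem_swF]

lemma swc_swc (c : ℕ × ℕ → ℂ) : swc (swc c) = c := by
  funext v; simp [swc]

lemma sw_sw (S : Seg) : S.sw.sw = S := by
  cases S; simp [Seg.sw]

lemma G0_sw (F : Finset (ℕ × ℕ)) (c : ℕ × ℕ → ℂ) (x y : ℂ) :
    G0 (swF F) (swc c) x y = G1 F c y x := by
  unfold G0 G1 swF swc
  rw [Finset.sum_image (by intro a _ b _ h; exact Prod.swap_injective h)]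
  apply Finset.sum_congr rfl
  intro v _
  simp; ring

lemma G1_sw (F : Finset (ℕ × ℕ)) (c : ℕ × ℕ → ℂ) (x y : ℂ) :
    G1 (swF F) (swc c) x y = G0 F c y x := by
  unfold G0 G1 swF swc
  rw [Finset.sum_image (by intro a _ b _ h; exact Prod.swap_injective h)]
  apply Finset.sum_congr rfl
  intro v _
  simp; ring

lemma lfun_sw (S : Seg) (v : ℕ × ℕ) : lfun S.sw v.swap = gfun S v := by
  simp [lfun, gfun, Seg.sw]

lemma rightSeg_iff (h : MvPolynomial (Fin 2) ℂ) (S : Seg) : RightSeg h S ↔ RS (supp h) S := Iff.rfl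

lemma topSeg_iff (h : MvPolynomial (Fin 2) ℂ) (S : Seg) :
    TopSeg h S ↔ RS (swF (supp h)) S.sw := by
  unfold TopSeg RS
  constructor
  · rintro ⟨h1, h2, h3, h4, h5⟩
    refine ⟨mem_swF.2 (by simpa [Seg.sw] using h1), mem_swF.2 (by simpa [Seg.sw] using h2),
      by simpa [Seg.sw] using h3, ?_, ?_⟩
    · intro v hv
      have := h4 _ (mem_swF.1 hv)
      rw [← lfun_sw, ← lfun_sw, Prod.swap_swap] at this
      exact this
    · intro v hv hh
      have := h5 _ (mem_swF.1 hv)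
      rw [← lfun_sw, ← lfun_sw, Prod.swap_swap] at this
      exact this hh
  · rintro ⟨h1, h2, h3, h4, h5⟩
    refine ⟨by simpa [Seg.sw] using mem_swF.1 h1, by simpa [Seg.sw] using mem_swF.1 h2,
      by simpa [Seg.sw] using h3, ?_, ?_⟩
    · intro v hv
      have := h4 v.swap (mem_swF.2 (by simpa using hv))
      rw [← lfun_sw, ← lfun_sw]
      exact this
    · intro v hv hh
      rw [← lfun_sw, ← lfun_sw] at hh
      exact h5 v.swap (mem_swF.2 (by simpa using hv)) hh

lemma decl_eq (S : Seg) (hS : S.P.2 < S.Q.2) :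
    decl S = ((S.P.1 : ℚ) - S.Q.1) / ((S.Q.2 : ℚ) - S.P.2) := by
  have h2 : (0 : ℚ) < (S.Q.2 : ℚ) - S.P.2 := by
    rw [sub_pos]; exact_mod_cast hS
  unfold decl len1 len2 sigmaR
  rw [abs_of_pos h2]
  split_ifs with h h'
  · simp [h]
  · have : (S.P.1 : ℚ) < S.Q.1 := by exact_mod_cast h'
    rw [abs_of_pos (by linarith)]; push_cast; ring
  · have : (S.Q.1 : ℚ) ≤ S.P.1 := by exact_mod_cast not_lt.1 h'
    rw [abs_of_nonpos (by linarith)]; push_cast; ring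

lemma alphaS_eq (S : Seg) (hS : S.P.2 < S.Q.2) :
    (alphaS S : ℝ) = (S.P.1 : ℝ) + S.P.2 * (((S.P.1 : ℝ) - S.Q.1) / ((S.Q.2 : ℝ) - S.P.2)) := by
  unfold alphaS
  rw [decl_eq S hS]; push_cast; rfl

lemma betaS_eq (S : Seg) : betaS S = alphaS S.sw := by
  rfl

lemma coeff2_ne (h : MvPolynomial (Fin 2) ℂ) (v : ℕ × ℕ) : v ∈ supp h ↔ coeff2 h v ≠ 0 := by
  unfold supp coeff2
  rw [Finset.mem_image]
  constructor
  · rintro ⟨d, hd, rfl⟩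
    rw [MvPolynomial.mem_support_iff] at hd
    convert hd
    ext i; fin_cases i <;> simp
  · intro hv
    refine ⟨_, MvPolynomial.mem_support_iff.2 hv, ?_⟩
    simp

lemma eq_sum_supp (h : MvPolynomial (Fin 2) ℂ) :
    h = ∑ p ∈ supp h,
      MvPolynomial.monomial (Finsupp.single 0 p.1 + Finsupp.single 1 p.2) (coeff2 h p) := by
  conv_lhs => rw [h.as_sum]
  unfold supp
  have key : ∀ d : Fin 2 →₀ ℕ, Finsupp.single 0 (d 0) + Finsupp.single 1 (d 1) = d := by
    intro d; ext i; fin_cases i <;> simp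
  rw [Finset.sum_image]
  · apply Finset.sum_congr rfl
    intro d _
    simp only [coeff2, key]
  · intro a _ b _ hab
    rw [← key a, ← key b]
    simp only [Prod.mk.injEq] at hab
    rw [hab.1, hab.2]

lemma eval_pderiv0 (F : Finset (ℕ × ℕ)) (c : ℕ × ℕ → ℂ) (x y : ℂ) :
    MvPolynomial.eval ![x, y] (MvPolynomial.pderiv (0 : Fin 2) (∑ p ∈ F,
      MvPolynomial.monomial (Finsupp.single 0 p.1 + Finsupp.single 1 p.2) (c p))) = G0 F c x y := by
  unfold G0
  rw [map_sum, map_sum]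
  apply Finset.sum_congr rfl
  intro v _
  rw [MvPolynomial.pderiv_monomial, MvPolynomial.eval_monomial, Finsupp.prod_fintype _ _ (by simp)]
  simp [Fin.prod_univ_two]; ring

lemma eval_pderiv1 (F : Finset (ℕ × ℕ)) (c : ℕ × ℕ → ℂ) (x y : ℂ) :
    MvPolynomial.eval ![x, y] (MvPolynomial.pderiv (1 : Fin 2) (∑ p ∈ F,
      MvPolynomial.monomial (Finsupp.single 0 p.1 + Finsupp.single 1 p.2) (c p))) = G1 F c x y := by
  unfold G1
  rw [map_sum, map_sum]
  apply Finset.sum_congr rfl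
  intro v _
  rw [MvPolynomial.pderiv_monomial, MvPolynomial.eval_monomial, Finsupp.prod_fintype _ _ (by simp)]
  simp [Fin.prod_univ_two]; ring

lemma gradMap_eq (h : MvPolynomial (Fin 2) ℂ) (z : ℂ × ℂ) :
    gradMap h z = (G0 (supp h) (coeff2 h) z.1 z.2, G1 (supp h) (coeff2 h) z.1 z.2) := by
  unfold gradMap
  rw [← eval_pderiv0, ← eval_pderiv1, ← eq_sum_supp]

/-! ### The upper bound -/

lemma exp_le_of_eventually {A C a b : ℝ} (hA : 0 < A)
    (hev : ∀ᶠ t : ℝ in Filter.atTop, A * t ^ a ≤ C * t ^ b) : a ≤ b := by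
  by_contra hab
  push Not at hab
  have h1 := (tendsto_rpow_atTop (sub_pos.2 hab)).eventually_gt_atTop (C / A)
  obtain ⟨t, ht1, ht2, ht3⟩ := (hev.and (h1.and (Filter.eventually_gt_atTop 0))).exists
  rw [Real.rpow_sub ht3, div_lt_div_iff₀ hA (Real.rpow_pos_of_pos ht3 _)] at ht2
  linarith

lemma bounded_root (p : ℝ → ℂ → ℂ) (hp : Continuous fun q : ℝ × ℂ => p q.1 q.2)
    (hd : ∀ s, Differentiable ℂ (p s)) (q : Polynomial ℂ) (hq : q.degree ≠ 0) (hq0 : q ≠ 0)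
    (hpq : ∀ u, p 0 u = q.eval u) :
    ∃ K : ℝ, ∀ᶠ s in nhds (0 : ℝ), ∃ u, ‖u‖ ≤ K ∧ p s u = 0 := by
  obtain ⟨u0, hu0⟩ := IsAlgClosed.exists_root q hq
  have hfin : ((fun z : ℂ => ‖z - u0‖) '' {z | q.IsRoot z}).Finite :=
    (Polynomial.finite_setOfPred_isRoot hq0).image _
  obtain ⟨r, hr, hr'⟩ := (Set.Ioo_infinite (zero_lt_one' ℝ)).exists_notMem_finite hfin
  have hne : ∀ z ∈ Metric.sphere u0 r, p 0 z ≠ 0 := by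
    intro z hz h0
    apply hr'
    refine ⟨z, ?_, ?_⟩
    · simpa [Polynomial.IsRoot, hpq] using h0
    · simpa [dist_eq_norm] using hz
  have hc0 : Continuous (p 0) := (hd 0).continuous
  have hm : ∃ m > 0, ∀ z ∈ Metric.sphere u0 r, m ≤ ‖p 0 z‖ := by
    obtain ⟨z, hz, hz'⟩ := (isCompact_sphere u0 r).exists_isMinOn
      (NormedSpace.sphere_nonempty.2 hr.1.le) (hc0.norm.continuousOn)
    exact ⟨‖p 0 z‖, norm_pos_iff.2 (hne z hz), fun w hw => hz' hw⟩
  obtain ⟨m, hm0, hm⟩ := hm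
  have hun : ∀ᶠ s in nhds (0 : ℝ), ∀ u ∈ Metric.closedBall u0 r, ‖p s u - p 0 u‖ < m / 4 := by
    apply (isCompact_closedBall u0 r).eventually_forall_of_forall_eventually
    intro u _
    have hcont : Continuous fun z : ℝ × ℂ => ‖p z.1 z.2 - p 0 z.2‖ :=
      (hp.sub (hc0.comp continuous_snd)).norm
    apply hcont.continuousAt.eventually_lt continuousAt_const
    simp; linarith
  refine ⟨‖u0‖ + 1, ?_⟩
  filter_upwards [hun] with s hs
  have hu0m : ‖p s u0‖ < m / 4 := by
    have := hs u0 (Metric.mem_closedBall_self hr.1.le)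
    rwa [hpq u0, hu0, sub_zero] at this
  have := DiffContOnCl.ball_subset_image_closedBall (f := p s) (z₀ := u0) (ε := m / 2)
    (hd s).diffContOnCl hr.1 (by
      intro z hz
      have h1 := hs z (Metric.sphere_subset_closedBall hz)
      have h2 := hm z hz
      have h3 : p 0 z = (p s z - p s u0) - (p s z - p 0 z) + p s u0 := by ring
      have h4 : ‖p 0 z‖ ≤ ‖p s z - p s u0‖ + ‖p s z - p 0 z‖ + ‖p s u0‖ := by
        conv_lhs => rw [h3]
        exact (norm_add_le _ _).trans (add_le_add_left (norm_sub_le _ _) _)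
      linarith) (by
      have : ∃ᶠ z in nhds u0, p s z ≠ p s u0 := by
        by_contra hcon
        rw [Filter.not_frequently] at hcon
        simp only [not_not] at hcon
        have hall : ∀ z, p s z = p s u0 := by
          have hA : AnalyticOnNhd ℂ (p s) Set.univ := fun z _ => (hd s).analyticAt z
          have hB : AnalyticOnNhd ℂ (fun _ : ℂ => p s u0) Set.univ := fun z _ => analyticAt_const
          intro z
          exact hA.eqOn_of_preconnected_of_eventuallyEq hB isPreconnected_univ (Set.mem_univ u0)
            hcon (Set.mem_univ z)
        obtain ⟨z, hz⟩ := (NormedSpace.sphere_nonempty (x := u0)).2 hr.1.le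
        have h1 := hs z (Metric.sphere_subset_closedBall hz)
        have h2 := hm z hz
        rw [hall z, norm_sub_rev] at h1
        have := norm_sub_norm_le (p 0 z) (p s u0)
        linarith
      exact this)
  have h0 : (0 : ℂ) ∈ Metric.ball (p s u0) (m / 2 / 2) := by
    rw [Metric.mem_ball, dist_eq_norm, zero_sub, norm_neg]; linarith
  obtain ⟨u, hu, hu'⟩ := this h0
  refine ⟨u, ?_, hu'⟩
  have h1 : ‖u - u0‖ ≤ r := by simpa [dist_eq_norm] using hu
  have := norm_sub_norm_le u u0
  have := hr.2
  linarith

lemma upper (F : Finset (ℕ × ℕ)) (c : ℕ × ℕ → ℂ) (hc : ∀ v ∈ F, c v ≠ 0) (S : Seg)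
    (hS : RS F S) (hQ : 2 ≤ S.Q.2) (hn : (S.P.1 : ℤ) - S.Q.1 ≤ S.Q.2 - S.P.2) (l : ℝ)
    (hl : ∃ k : ℝ, 0 < k ∧ ∃ R : ℝ, ∀ x y : ℂ, R ≤ max ‖x‖ ‖y‖ →
      k * (max ‖x‖ ‖y‖) ^ l ≤ max ‖G0 F c x y‖ ‖G1 F c x y‖) :
    l ≤ (alphaS S : ℝ) - 1 := by
  obtain ⟨hP, hQF, hPQ, hle, heq⟩ := hS
  obtain ⟨k, hk, R, hl⟩ := hl
  set n1 : ℤ := (S.Q.2 : ℤ) - S.P.2 with hn1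
  set n2 : ℤ := (S.P.1 : ℤ) - S.Q.1 with hn2
  set d : ℤ := lfun S S.P with hd
  have hlf : ∀ v, lfun S v = n1 * v.1 + n2 * v.2 := by
    intro v; unfold lfun; rw [hn1, hn2]; ring
  have hn1pos : 0 < n1 := by rw [hn1]; omega
  set e : ℕ × ℕ → ℕ := fun v => (d - lfun S v).toNat with he
  have hev : ∀ v ∈ F, (e v : ℤ) = d - lfun S v := by
    intro v hv; have := hle v hv
    simp only [he]; omega
  set pY : ℝ → ℂ → ℂ := fun s u => ∑ v ∈ F, c v * v.2 * (s : ℂ) ^ e v * u ^ (v.2 - 1) with hpY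
  set pX : ℝ → ℂ → ℂ := fun s u => ∑ v ∈ F, c v * v.1 * (s : ℂ) ^ e v * u ^ v.2 with hpX
  set q : Polynomial ℂ := ∑ v ∈ F, Polynomial.monomial (v.2 - 1) (c v * v.2 * (0 : ℂ) ^ e v) with hq
  have hcoeff : q.coeff (S.Q.2 - 1) ≠ 0 := by
    rw [hq, Polynomial.finsetSum_coeff, Finset.sum_eq_single S.Q]
    · have : e S.Q = 0 := by
        have h1 := hev _ hQF
        have : lfun S S.Q = d := by rw [hd]; unfold lfun; ring
        omega
      rw [Polynomial.coeff_monomial, if_pos rfl, this]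
      have h2 : (S.Q.2 : ℂ) ≠ 0 := by
        norm_cast; omega
      simp [hc _ hQF, h2]
    · intro v hv hne
      rw [Polynomial.coeff_monomial]
      split_ifs with h1
      · by_cases h2 : e v = 0
        · exfalso
          have h3 := hev v hv
          rw [h2] at h3
          have h4 : v.2 = S.Q.2 := by omega
          have h5 : lfun S S.Q = d := by rw [hd]; unfold lfun; ring
          have h6 : lfun S v = lfun S S.Q := by rw [h5]; simp at h3; linarith
          rw [hlf, hlf, h4] at h6
          have h7 : n1 * (v.1 : ℤ) = n1 * S.Q.1 := by linarith
          have h8 := mul_left_cancel₀ hn1pos.ne' h7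
          exact hne (Prod.ext (by exact_mod_cast h8) h4)
        · simp [h2]
      · rfl
    · intro h; exact absurd hQF h
  have hq0 : q ≠ 0 := by
    intro h; rw [h] at hcoeff; simp at hcoeff
  have hqd : q.degree ≠ 0 := by
    have := Polynomial.le_degree_of_ne_zero hcoeff
    intro h; rw [h] at this
    have : S.Q.2 - 1 ≤ 0 := by exact_mod_cast this
    omega
  have hpYc : Continuous fun z : ℝ × ℂ => pY z.1 z.2 := by
    simp only [hpY]; fun_prop
  have hpXc : Continuous fun z : ℝ × ℂ => pX z.1 z.2 := by
    simp only [hpX]; fun_prop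
  obtain ⟨K, hK⟩ := bounded_root pY hpYc (by intro s; simp only [hpY]; fun_prop) q hqd hq0 (by
    intro u; simp [hpY, hq, Polynomial.eval_finsetSum])
  obtain ⟨C, hC⟩ := ((isCompact_Icc (a := (0 : ℝ)) (b := 1)).prod
    (isCompact_closedBall (0 : ℂ) K)).exists_bound_of_continuousOn hpXc.continuousOn
  have hG0 : ∀ t : ℝ, 0 < t → ∀ u : ℂ, G0 F c ((t : ℂ) ^ n1) ((t : ℂ) ^ n2 * u) =
      (t : ℂ) ^ (d - n1) * pX t⁻¹ u := by
    intro t ht u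
    have ht' : (t : ℂ) ≠ 0 := by exact_mod_cast ht.ne'
    simp only [G0, hpX]
    rw [Finset.mul_sum]
    apply Finset.sum_congr rfl
    intro v hv
    rcases Nat.eq_zero_or_pos v.1 with h | h
    · simp [h]
    · have h1 : ((t : ℂ) ^ n1) ^ (v.1 - 1) * ((t : ℂ) ^ n2) ^ v.2 =
          (t : ℂ) ^ (d - n1) * ((t⁻¹ : ℝ) : ℂ) ^ e v := by
        push_cast
        rw [inv_pow, ← zpow_natCast, ← zpow_natCast, ← zpow_natCast, ← zpow_mul, ← zpow_mul,
          ← zpow_neg, ← zpow_add₀ ht', ← zpow_add₀ ht', hev v hv, hlf]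
        congr 1
        rw [Nat.cast_sub h]; push_cast; ring
      rw [mul_pow]
      linear_combination (c v * v.1 * u ^ v.2) * h1
  have hG1 : ∀ t : ℝ, 0 < t → ∀ u : ℂ, G1 F c ((t : ℂ) ^ n1) ((t : ℂ) ^ n2 * u) =
      (t : ℂ) ^ (d - n2) * pY t⁻¹ u := by
    intro t ht u
    have ht' : (t : ℂ) ≠ 0 := by exact_mod_cast ht.ne'
    simp only [G1, hpY]
    rw [Finset.mul_sum]
    apply Finset.sum_congr rfl
    intro v hv
    rcases Nat.eq_zero_or_pos v.2 with h | h
    · simp [h]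
    · have h1 : ((t : ℂ) ^ n1) ^ v.1 * ((t : ℂ) ^ n2) ^ (v.2 - 1) =
          (t : ℂ) ^ (d - n2) * ((t⁻¹ : ℝ) : ℂ) ^ e v := by
        push_cast
        rw [inv_pow, ← zpow_natCast, ← zpow_natCast, ← zpow_natCast, ← zpow_mul, ← zpow_mul,
          ← zpow_neg, ← zpow_add₀ ht', ← zpow_add₀ ht', hev v hv, hlf]
        congr 1
        rw [Nat.cast_sub h]; push_cast; ring
      rw [mul_pow]
      linear_combination (c v * v.2 * u ^ (v.2 - 1)) * h1
  set K' : ℝ := max 1 K with hK'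
  have hK'1 : 1 ≤ K' := le_max_left _ _
  set A : ℝ := min 1 (K' ^ l) with hA
  have hApos : 0 < A := lt_min one_pos (Real.rpow_pos_of_pos (by linarith) _)
  have hmain : ∀ᶠ t : ℝ in Filter.atTop, (k * A) * t ^ ((n1 : ℝ) * l) ≤ C * t ^ ((d : ℝ) - n1) := by
    have hK2 := tendsto_inv_atTop_zero.eventually hK
    filter_upwards [hK2, Filter.eventually_ge_atTop 1, Filter.eventually_ge_atTop R]
      with t ⟨u, hu, hu0⟩ ht1 htR
    have ht0 : 0 < t := by linarith
    have hx : ‖(t : ℂ) ^ n1‖ = t ^ n1 := by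
      rw [norm_zpow, Complex.norm_real, Real.norm_of_nonneg ht0.le]
    have hy : ‖(t : ℂ) ^ n2 * u‖ = t ^ n2 * ‖u‖ := by
      rw [norm_mul, norm_zpow, Complex.norm_real, Real.norm_of_nonneg ht0.le]
    set N := max ‖(t : ℂ) ^ n1‖ ‖(t : ℂ) ^ n2 * u‖ with hN
    have hT : 0 < t ^ n1 := zpow_pos ht0 _
    have hN1 : t ^ n1 ≤ N := by rw [← hx]; exact le_max_left _ _
    have hN2 : N ≤ K' * t ^ n1 := by
      apply max_le
      · rw [hx]; nlinarith
      · rw [hy, mul_comm]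
        exact mul_le_mul (hu.trans (le_max_right _ _)) (zpow_le_zpow_right₀ ht1 hn)
          (zpow_pos ht0 _).le (by linarith)
    have hRN : R ≤ N := by
      refine htR.trans (le_trans ?_ hN1)
      calc t = t ^ (1 : ℤ) := by simp
        _ ≤ t ^ n1 := zpow_le_zpow_right₀ ht1 hn1pos
    have h1 := hl _ _ hRN
    rw [hG0 t ht0, hG1 t ht0, hu0, mul_zero, norm_zero, max_eq_left (norm_nonneg _), ← hN, norm_mul,
      norm_zpow, Complex.norm_real, Real.norm_of_nonneg ht0.le] at h1
    have h2 := hC (t⁻¹, u) ⟨⟨by positivity, inv_le_one_of_one_le₀ ht1⟩, by simpa using hu⟩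
    simp only at h2
    have h3 : A * (t ^ n1) ^ l ≤ N ^ l := by
      rcases le_total 0 l with h0 | h0
      · calc A * (t ^ n1) ^ l ≤ 1 * (t ^ n1) ^ l :=
            mul_le_mul_of_nonneg_right (min_le_left _ _) (Real.rpow_nonneg hT.le _)
          _ = (t ^ n1) ^ l := one_mul _
          _ ≤ N ^ l := Real.rpow_le_rpow hT.le hN1 h0
      · calc A * (t ^ n1) ^ l ≤ K' ^ l * (t ^ n1) ^ l :=
            mul_le_mul_of_nonneg_right (min_le_right _ _) (Real.rpow_nonneg hT.le _)
          _ = (K' * t ^ n1) ^ l := (Real.mul_rpow (by linarith) hT.le).symm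
          _ ≤ N ^ l := Real.rpow_le_rpow_of_nonpos (by linarith) hN2 h0
    have h4 : t ^ ((n1 : ℝ) * l) = (t ^ n1) ^ l := by
      rw [Real.rpow_mul ht0.le, Real.rpow_intCast]
    have h5 : t ^ ((d : ℝ) - n1) = t ^ (d - n1) := by
      rw [← Real.rpow_intCast]; push_cast; rfl
    rw [h4, h5]
    calc k * A * (t ^ n1) ^ l = k * (A * (t ^ n1) ^ l) := by ring
      _ ≤ k * N ^ l := mul_le_mul_of_nonneg_left h3 hk.le
      _ ≤ t ^ (d - n1) * ‖pX t⁻¹ u‖ := h1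
      _ ≤ t ^ (d - n1) * C := mul_le_mul_of_nonneg_left h2 (zpow_pos ht0 _).le
      _ = C * t ^ (d - n1) := mul_comm _ _
  have hfin := exp_le_of_eventually (mul_pos hk hApos) hmain
  rw [alphaS_eq S hPQ]
  have hn1r : (n1 : ℝ) = (S.Q.2 : ℝ) - S.P.2 := by rw [hn1]; push_cast; rfl
  have hn2r : (n2 : ℝ) = (S.P.1 : ℝ) - S.Q.1 := by rw [hn2]; push_cast; rfl
  have hdr : (d : ℝ) = n1 * S.P.1 + n2 * S.P.2 := by rw [hd, hlf]; push_cast; rfl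
  rw [← hn1r, ← hn2r]
  have hpos : (0 : ℝ) < n1 := by exact_mod_cast hn1pos
  rw [hdr] at hfin
  rw [← mul_le_mul_iff_right₀ hpos]
  calc (n1 : ℝ) * l ≤ _ := hfin
    _ = _ := by field_simp

/-- reversal of a right segment of negative slope, as a right segment of the swapped set. -/
def Seg.flip (S : Seg) : Seg := ⟨S.Q.swap, S.P.swap⟩

lemma lfun_flip (S : Seg) (v : ℕ × ℕ) : lfun S.flip v = lfun S v.swap := by
  simp [lfun, Seg.flip]; ring

lemma lfun_Q (S : Seg) : lfun S S.Q = lfun S S.P := by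
  unfold lfun; ring

lemma RS_flip {F : Finset (ℕ × ℕ)} {S : Seg} (hS : RS F S) (h : S.Q.1 < S.P.1) :
    RS (swF F) S.flip := by
  obtain ⟨hP, hQF, hPQ, hle, heq⟩ := hS
  have hPP : lfun S.flip S.flip.P = lfun S S.P := by
    rw [lfun_flip, ← lfun_Q]; rfl
  refine ⟨mem_swF.2 (by simpa [Seg.flip] using hQF), mem_swF.2 (by simpa [Seg.flip] using hP),
    by simpa [Seg.flip] using h, ?_, ?_⟩
  · intro v hv
    rw [hPP, lfun_flip]
    exact hle _ (mem_swF.1 hv)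
  · intro v hv hh
    rw [hPP, lfun_flip] at hh
    have h1 := heq _ (mem_swF.1 hv) hh
    simp only [Prod.snd_swap] at h1
    have h2 : lfun S v.swap = lfun S S.Q := by rw [hh, lfun_Q]
    unfold lfun at hh h2
    simp only [Prod.fst_swap, Prod.snd_swap] at hh h2
    simp only [Seg.flip, Prod.snd_swap]
    zify at *
    constructor
    · by_contra hcon
      push Not at hcon
      nlinarith [mul_nonneg (sub_nonneg.2 h.le) (sub_nonneg.2 h1.2),
        mul_pos (sub_pos.2 hPQ) (sub_pos.2 hcon)]
    · by_contra hcon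
      push Not at hcon
      nlinarith [mul_nonneg (sub_nonneg.2 h.le) (sub_nonneg.2 h1.1),
        mul_pos (sub_pos.2 hPQ) (sub_pos.2 hcon)]

lemma nonexc_iff {F : Finset (ℕ × ℕ)} {S : Seg} (hS : RS F S) : ¬ RExcep S ↔ 2 ≤ S.Q.2 := by
  have := hS.2.2.1
  unfold RExcep
  omega

lemma flip_alpha_le {F : Finset (ℕ × ℕ)} {S : Seg} (hS : RS F S)
    (h : (S.Q.2 : ℤ) - S.P.2 < S.P.1 - S.Q.1) :
    (alphaS S.flip : ℝ) ≤ alphaS S := by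
  have hPQ := hS.2.2.1
  rw [alphaS_eq S hPQ, alphaS_eq S.flip (by simp [Seg.flip]; omega)]
  simp only [Seg.flip, Prod.fst_swap, Prod.snd_swap]
  have h' : (S.Q.2 : ℝ) - S.P.2 < S.P.1 - S.Q.1 := by exact_mod_cast h
  have hn1 : (0 : ℝ) < (S.Q.2 : ℝ) - S.P.2 := by
    rw [sub_pos]; exact_mod_cast hPQ
  set a := (S.Q.2 : ℝ) - S.P.2
  set b := (S.P.1 : ℝ) - S.Q.1
  have hb : 0 < b := by linarith
  have e1 : (S.Q.2 : ℝ) + S.Q.1 * (a / b) = (a * S.P.1 + b * S.P.2) / b := by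
    field_simp
    simp only [a, b]; ring
  have e2 : (S.P.1 : ℝ) + S.P.2 * (b / a) = (a * S.P.1 + b * S.P.2) / a := by
    field_simp
  rw [e1, e2]
  apply div_le_div_of_nonneg_left _ hn1 h'.le
  positivity

lemma upper_right (F : Finset (ℕ × ℕ)) (c : ℕ × ℕ → ℂ) (hc : ∀ v ∈ F, c v ≠ 0) (S : Seg)
    (hS : RS F S) (hex : ¬ RExcep S) (l : ℝ)
    (hl : ∃ k : ℝ, 0 < k ∧ ∃ R : ℝ, ∀ x y : ℂ, R ≤ max ‖x‖ ‖y‖ →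
      k * (max ‖x‖ ‖y‖) ^ l ≤ max ‖G0 F c x y‖ ‖G1 F c x y‖) :
    l ≤ (alphaS S : ℝ) - 1 := by
  have hQ := (nonexc_iff hS).1 hex
  rcases le_or_gt ((S.P.1 : ℤ) - S.Q.1) ((S.Q.2 : ℤ) - S.P.2) with h | h
  · exact upper F c hc S hS hQ h l hl
  · have hPQ := hS.2.2.1
    have h1 : S.Q.1 < S.P.1 := by omega
    have := upper (swF F) (swc c) (fun v hv => hc _ (mem_swF.1 hv)) S.flip (RS_flip hS h1)
      (by simp [Seg.flip]; omega) (by simp [Seg.flip]; omega) l (by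
        obtain ⟨k, hk, R, hl⟩ := hl
        refine ⟨k, hk, R, ?_⟩
        intro x y hR
        rw [G0_sw, G1_sw, max_comm ‖x‖, max_comm ‖G1 F c y x‖]
        exact hl y x (by rwa [max_comm]))
    linarith [flip_alpha_le hS h]

/-! ### Combinatorics for the lower bound -/

lemma deg_bound (F : Finset (ℕ × ℕ)) (b : ℝ)
    (hR : ∀ S, RS F S → ¬ RExcep S → b ≤ alphaS S)
    (hT : ∀ S, RS (swF F) S → ¬ RExcep S → b ≤ alphaS S)
    (S : Seg) (hS : RS F S) (hex : ¬ RExcep S) : ∃ v ∈ F, b ≤ (v.1 : ℝ) + v.2 := by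
  have key : ∀ (F : Finset (ℕ × ℕ)) (S : Seg), RS F S → b ≤ alphaS S →
      ((S.P.1 : ℤ) - S.Q.1) ≤ ((S.Q.2 : ℤ) - S.P.2) → b ≤ (S.P.1 : ℝ) + S.P.2 := by
    intro F S hS hb h
    have hPQ := hS.2.2.1
    rw [alphaS_eq S hPQ] at hb
    have h' : (S.P.1 : ℝ) - S.Q.1 ≤ (S.Q.2 : ℝ) - S.P.2 := by exact_mod_cast h
    have hn1 : (0 : ℝ) < (S.Q.2 : ℝ) - S.P.2 := by
      rw [sub_pos]; exact_mod_cast hPQ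
    have := (div_le_one hn1).2 h'
    have hP2 : (0 : ℝ) ≤ S.P.2 := by positivity
    nlinarith
  rcases le_or_gt ((S.P.1 : ℤ) - S.Q.1) ((S.Q.2 : ℤ) - S.P.2) with h | h
  · exact ⟨S.P, hS.1, key F S hS (hR S hS hex) h⟩
  · have hPQ := hS.2.2.1
    have h1 : S.Q.1 < S.P.1 := by omega
    have hF := RS_flip hS h1
    have := key (swF F) S.flip hF (hT _ hF ((nonexc_iff hF).2 (by simp [Seg.flip]; omega)))
      (by simp [Seg.flip]; omega)
    refine ⟨S.Q, hS.2.1, ?_⟩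
    simp only [Seg.flip, Prod.fst_swap, Prod.snd_swap] at this
    linarith

lemma exists_top (F : Finset (ℕ × ℕ)) (P : ℕ × ℕ) (hT : ∃ v ∈ F, P.2 < v.2) :
    ∃ Q ∈ F, P.2 < Q.2 ∧ ∀ v ∈ F, P.2 < v.2 → lfun ⟨P, Q⟩ v ≤ lfun ⟨P, Q⟩ P ∧
      (lfun ⟨P, Q⟩ v = lfun ⟨P, Q⟩ P → v.2 ≤ Q.2) := by
  set f : ℕ × ℕ → ℚ := fun v => ((P.1 : ℚ) - v.1) / ((v.2 : ℚ) - P.2) with hf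
  set T := F.filter (fun v => P.2 < v.2) with hTd
  have hTne : T.Nonempty := by
    obtain ⟨v, hv, hv'⟩ := hT
    exact ⟨v, by simp [hTd, hv, hv']⟩
  obtain ⟨Q0, hQ0, hmin⟩ := T.exists_min_image f hTne
  obtain ⟨Q, hQ, hmax⟩ := (T.filter (fun v => f v = f Q0)).exists_max_image (fun v => v.2)
    ⟨Q0, by simp [hQ0]⟩
  simp only [hTd, Finset.mem_filter] at hQ hmin hmax
  have hQpos : (0 : ℚ) < (Q.2 : ℚ) - P.2 := by rw [sub_pos]; exact_mod_cast hQ.1.2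
  refine ⟨Q, hQ.1.1, hQ.1.2, ?_⟩
  intro v hv hv2
  have hvpos : (0 : ℚ) < (v.2 : ℚ) - P.2 := by rw [sub_pos]; exact_mod_cast hv2
  have hfv : f Q ≤ f v := by rw [hQ.2]; exact hmin v ⟨hv, hv2⟩
  have hl : ((lfun ⟨P, Q⟩ P - lfun ⟨P, Q⟩ v : ℤ) : ℚ) =
      ((Q.2 : ℚ) - P.2) * ((v.2 : ℚ) - P.2) * (f v - f Q) := by
    simp only [hf, lfun]
    push_cast
    field_simp
    ring
  constructor
  · have : (0 : ℚ) ≤ ((lfun ⟨P, Q⟩ P - lfun ⟨P, Q⟩ v : ℤ) : ℚ) := by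
      rw [hl]
      exact mul_nonneg (mul_pos hQpos hvpos).le (sub_nonneg.2 hfv)
    have : 0 ≤ lfun ⟨P, Q⟩ P - lfun ⟨P, Q⟩ v := by exact_mod_cast this
    linarith
  · intro heq
    rw [heq, sub_self] at hl
    have h0 : f v - f Q = 0 := by
      rcases mul_eq_zero.1 hl.symm with h | h
      · exact absurd h (mul_pos hQpos hvpos).ne'
      · exact h
    exact hmax v ⟨⟨hv, hv2⟩, by rw [← hQ.2]; linarith⟩

/-- the sub-case where the vertex `(p,1)` dominates near the horizontal axis. -/
lemma comb_sub (F : Finset (ℕ × ℕ)) (b : ℝ)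
    (hR : ∀ S, RS F S → ¬ RExcep S → b ≤ alphaS S)
    (hdeg : ∃ v ∈ F, b ≤ (v.1 : ℝ) + v.2)
    (p : ℕ) (hp : (p, 1) ∈ F) (hpmax : ∀ v ∈ F, v.2 = 1 → v.1 ≤ p)
    (h0 : ∀ u ∈ F, u.2 = 0 → u.1 ≤ p + 1 ∧ ∀ v ∈ F, 2 ≤ v.2 →
      ((u.1 : ℤ) - p) * (v.2 - 1) < p - v.1) :
    ∃ (p : ℕ) (δ : ℝ), (p, 1) ∈ F ∧ δ ≤ 1 ∧ b ≤ p + δ ∧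
      (∀ v ∈ F, v.2 = 1 → v.1 ≤ p) ∧ ∀ v ∈ F, 2 ≤ v.2 → v.1 + δ * ((v.2 : ℝ) - 1) ≤ p := by
  by_cases hall : ∀ v ∈ F, 2 ≤ v.2 → v.1 + v.2 ≤ p + 1
  · refine ⟨p, 1, hp, le_rfl, ?_, hpmax, ?_⟩
    · obtain ⟨v, hv, hb⟩ := hdeg
      refine hb.trans ?_
      have : v.1 + v.2 ≤ p + 1 := by
        rcases lt_or_ge v.2 2 with h | h
        · rcases Nat.lt_or_ge v.2 1 with h' | h'
          · have := (h0 v hv (by omega)).1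
            omega
          · have := hpmax v hv (by omega)
            omega
        · exact hall v hv h
      exact_mod_cast this
    · intro v hv hv2
      have := hall v hv hv2
      have : (v.1 : ℝ) + v.2 ≤ p + 1 := by exact_mod_cast this
      linarith
  · push Not at hall
    obtain ⟨w, hw, hw2, hww⟩ := hall
    obtain ⟨Q, hQ, hQ2, hQm⟩ := exists_top F (p, 1) ⟨w, hw, hw2⟩
    simp only at hQ2
    have hRS : RS F ⟨(p, 1), Q⟩ := by
      refine ⟨hp, hQ, hQ2, ?_, ?_⟩
      · intro v hv
        rcases lt_trichotomy v.2 1 with h | h | h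
        · have := (h0 v hv (by omega)).2 Q hQ hQ2
          have h00 : v.2 = 0 := by omega
          simp only [lfun, h00]
          push_cast
          nlinarith
        · have := hpmax v hv h
          simp only [lfun, h]
          have h3 : (1 : ℤ) < Q.2 := by exact_mod_cast hQ2
          have h4 : (v.1 : ℤ) ≤ p := by exact_mod_cast this
          push_cast
          nlinarith
        · exact (hQm v hv h).1
      · intro v hv hvl
        rcases lt_trichotomy v.2 1 with h | h | h
        · exfalso
          have := (h0 v hv (by omega)).2 Q hQ hQ2
          have h00 : v.2 = 0 := by omega
          simp only [lfun, h00] at hvl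
          push_cast at hvl
          nlinarith
        · simp only; omega
        · exact ⟨h.le, (hQm v hv h).2 hvl⟩
    have hb := hR _ hRS ((nonexc_iff hRS).2 hQ2)
    rw [alphaS_eq _ hQ2] at hb
    simp only [Nat.cast_one, one_mul] at hb
    have hQpos : (0 : ℝ) < (Q.2 : ℝ) - 1 := by
      rw [sub_pos]; exact_mod_cast hQ2
    refine ⟨p, _, hp, ?_, hb, hpmax, ?_⟩
    · rw [div_le_one hQpos]
      have h1 := (hQm w hw hw2).1
      simp only [lfun] at h1
      have h1' : ((Q.2 : ℝ) - 1) * w.1 - ((Q.1 : ℝ) - p) * w.2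
          ≤ ((Q.2 : ℝ) - 1) * p - ((Q.1 : ℝ) - p) * 1 := by exact_mod_cast h1
      have h2 : (p : ℝ) + 1 < w.1 + w.2 := by exact_mod_cast hww
      have h3 : (1 : ℝ) < w.2 := by exact_mod_cast hw2
      by_contra hcon
      push Not at hcon
      nlinarith
    · intro v hv hv2
      have h1 := (hQm v hv hv2).1
      simp only [lfun] at h1
      have h1' : ((Q.2 : ℝ) - 1) * v.1 - ((Q.1 : ℝ) - p) * v.2
          ≤ ((Q.2 : ℝ) - 1) * p - ((Q.1 : ℝ) - p) * 1 := by exact_mod_cast h1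
      rw [← mul_le_mul_iff_right₀ hQpos]
      have : ((Q.2 : ℝ) - 1) * (v.1 + ((p : ℝ) - Q.1) / ((Q.2 : ℝ) - 1) * ((v.2 : ℝ) - 1)) =
        ((Q.2 : ℝ) - 1) * v.1 + ((p : ℝ) - Q.1) * ((v.2 : ℝ) - 1) := by field_simp
      rw [this]
      linarith

lemma comb (F : Finset (ℕ × ℕ)) (b : ℝ)
    (hR : ∀ S, RS F S → ¬ RExcep S → b ≤ alphaS S)
    (hdeg : ∃ v ∈ F, b ≤ (v.1 : ℝ) + v.2)
    (hlow : ∃ v ∈ F, v.2 ≤ 1) (hup : ∃ v ∈ F, 1 ≤ v.2) :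
    (∃ a : ℕ, (a, 0) ∈ F ∧ b ≤ a) ∨
    ∃ (p : ℕ) (δ : ℝ), (p, 1) ∈ F ∧ δ ≤ 1 ∧ b ≤ p + δ ∧
      (∀ v ∈ F, v.2 = 1 → v.1 ≤ p) ∧ ∀ v ∈ F, 2 ≤ v.2 → v.1 + δ * ((v.2 : ℝ) - 1) ≤ p := by
  by_cases hz : ∃ v ∈ F, v.2 = 0
  · obtain ⟨v0, hv0, hv02⟩ := hz
    obtain ⟨A, hA, hAmax⟩ := (F.filter (fun v => v.2 = 0)).exists_max_image (fun v => v.1)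
      ⟨v0, by simp [hv0, hv02]⟩
    simp only [Finset.mem_filter] at hA hAmax
    obtain ⟨a, a2⟩ := A
    obtain ⟨hAF, ha2⟩ := hA
    simp only at ha2 hAmax
    subst ha2
    by_cases hall : ∀ v ∈ F, v.1 + v.2 ≤ a
    · left
      obtain ⟨v, hv, hb⟩ := hdeg
      exact ⟨a, hAF, hb.trans (by exact_mod_cast hall v hv)⟩
    push Not at hall
    obtain ⟨w, hw, hww⟩ := hall
    obtain ⟨Q, hQ, hQ2, hQm⟩ := exists_top F (a, 0) (by
      obtain ⟨v, hv, hv'⟩ := hup; exact ⟨v, hv, hv'⟩)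
    simp only at hQ2
    have hw2 : 0 < w.2 := by
      by_contra h
      have := hAmax w ⟨hw, by omega⟩
      omega
    have hRS : RS F ⟨(a, 0), Q⟩ := by
      refine ⟨hAF, hQ, hQ2, ?_, ?_⟩
      · intro v hv
        rcases Nat.eq_zero_or_pos v.2 with h | h
        · have := hAmax v ⟨hv, h⟩
          simp only [lfun, h]
          have h3 : (0 : ℤ) < Q.2 := by exact_mod_cast hQ2
          have h4 : (v.1 : ℤ) ≤ a := by exact_mod_cast this
          push_cast
          nlinarith
        · exact (hQm v hv h).1
      · intro v hv hvl
        rcases Nat.eq_zero_or_pos v.2 with h | h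
        · simp only; omega
        · exact ⟨h.le, (hQm v hv h).2 hvl⟩
    rcases Nat.lt_or_ge Q.2 2 with hQ1 | hQ1
    · right
      have hQ1' : Q.2 = 1 := by omega
      have hQm' : ∀ v ∈ F, 0 < v.2 → (v.1 : ℤ) + (a - Q.1) * v.2 ≤ a := by
        intro v hv hv2
        have := (hQm v hv hv2).1
        simp only [lfun, hQ1'] at this
        push_cast at this
        linarith
      have hQm2 : ∀ v ∈ F, 2 ≤ v.2 → (v.1 : ℤ) + (a - Q.1) * v.2 < a := by
        intro v hv hv2
        refine lt_of_le_of_ne (hQm' v hv (by omega)) ?_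
        intro heq
        have := (hQm v hv (by omega)).2 (by
          simp only [lfun, hQ1']
          push_cast
          linarith)
        omega
      have haQ : (a : ℤ) - Q.1 < 1 := by
        have h1 := hQm' w hw hw2
        have h2 : (a : ℤ) < w.1 + w.2 := by exact_mod_cast hww
        by_contra hcon
        push Not at hcon
        have h3 : (0 : ℤ) < w.2 := by exact_mod_cast hw2
        nlinarith
      refine comb_sub F b hR hdeg Q.1 ?_ ?_ ?_
      · have : (Q.1, 1) = Q := by rw [← hQ1']
        rw [this]; exact hQ
      · intro v hv hv2
        have := hQm' v hv (by omega)
        rw [hv2] at this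
        push_cast at this
        omega
      · intro u hu hu2
        have hua := hAmax u ⟨hu, hu2⟩
        refine ⟨by omega, ?_⟩
        intro v hv hv2
        have h1 := hQm2 v hv hv2
        have h2 : (u.1 : ℤ) ≤ a := by exact_mod_cast hua
        have h3 : (2 : ℤ) ≤ v.2 := by exact_mod_cast hv2
        nlinarith
    · left
      have hb := hR _ hRS ((nonexc_iff hRS).2 hQ1)
      rw [alphaS_eq _ hQ2] at hb
      refine ⟨a, hAF, ?_⟩
      simpa using hb
  · right
    push Not at hz
    obtain ⟨v0, hv0, hv02⟩ := hlow
    obtain ⟨A, hA, hAmax⟩ := (F.filter (fun v => v.2 = 1)).exists_max_image (fun v => v.1)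
      ⟨v0, by have := hz v0 hv0; simp [hv0]; omega⟩
    simp only [Finset.mem_filter] at hA hAmax
    refine comb_sub F b hR hdeg A.1 ?_ ?_ ?_
    · have : (A.1, 1) = A := by rw [← hA.2]
      rw [this]; exact hA.1
    · intro v hv hv2
      exact hAmax v ⟨hv, hv2⟩
    · intro u hu hu2
      exact absurd hu2 (hz u hu)

/-! ### The lower bound -/

/-- scalar product of an integer vector with a lattice point. -/
def ip (n : ℤ × ℤ) (v : ℕ × ℕ) : ℤ := n.1 * v.1 + n.2 * v.2

/-- abstract nondegeneracy at infinity. -/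
def ND (F : Finset (ℕ × ℕ)) (c : ℕ × ℕ → ℂ) : Prop :=
  ∀ n : ℤ × ℤ, (0 < n.1 ∨ 0 < n.2) → ∀ v0 ∈ F, (∀ v ∈ F, ip n v ≤ ip n v0) →
    (∃ v ∈ F, v ≠ v0 ∧ ip n v = ip n v0) → ∀ x y : ℂ, x ≠ 0 → y ≠ 0 →
    G0 (F.filter fun v => ip n v = ip n v0) c x y = 0 →
    G1 (F.filter fun v => ip n v = ip n v0) c x y = 0 → False

lemma mul_G0 (F : Finset (ℕ × ℕ)) (c : ℕ × ℕ → ℂ) (x y : ℂ) :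
    x * G0 F c x y = ∑ v ∈ F, c v * v.1 * (x ^ v.1 * y ^ v.2) := by
  unfold G0
  rw [Finset.mul_sum]
  apply Finset.sum_congr rfl
  intro v _
  rcases Nat.eq_zero_or_pos v.1 with h | h
  · simp [h]
  · obtain ⟨m, hm⟩ : ∃ m, v.1 = m + 1 := ⟨v.1 - 1, by omega⟩
    rw [hm]; simp only [Nat.add_sub_cancel]; ring

lemma mul_G1 (F : Finset (ℕ × ℕ)) (c : ℕ × ℕ → ℂ) (x y : ℂ) :
    y * G1 F c x y = ∑ v ∈ F, c v * v.2 * (x ^ v.1 * y ^ v.2) := by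
  unfold G1
  rw [Finset.mul_sum]
  apply Finset.sum_congr rfl
  intro v _
  rcases Nat.eq_zero_or_pos v.2 with h | h
  · simp [h]
  · obtain ⟨m, hm⟩ : ∃ m, v.2 = m + 1 := ⟨v.2 - 1, by omega⟩
    rw [hm]; simp only [Nat.add_sub_cancel]; ring

lemma ultra_lim (U : Ultrafilter ℕ) (f : ℕ → ℂ) (a b : ℝ)
    (h : ∀ᶠ n in (U : Filter ℕ), a ≤ ‖f n‖ ∧ ‖f n‖ ≤ b) :
    ∃ z : ℂ, a ≤ ‖z‖ ∧ Filter.Tendsto f U (nhds z) := by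
  have hK : IsCompact {z : ℂ | a ≤ ‖z‖ ∧ ‖z‖ ≤ b} := by
    apply (isCompact_closedBall (0 : ℂ) b).of_isClosed_subset
    · exact (isClosed_le continuous_const continuous_norm).inter
        (isClosed_le continuous_norm continuous_const)
    · intro z hz; simpa using hz.2
  obtain ⟨z, hz, hz'⟩ := hK.ultrafilter_le_nhds (U.map f) (by
    rw [Filter.le_principal_iff]; exact h)
  exact ⟨z, hz.1, hz'⟩

lemma norm_mono {x y : ℂ} (hx : x ≠ 0) (hy : y ≠ 0) (v : ℕ × ℕ) :
    Real.log ‖x ^ v.1 * y ^ v.2‖ = v.1 * Real.log ‖x‖ + v.2 * Real.log ‖y‖ := by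
  rw [norm_mul, norm_pow, norm_pow, Real.log_mul (by positivity) (by positivity), Real.log_pow,
    Real.log_pow]

set_option maxHeartbeats 2000000 in
/-- the final step: a limit configuration along a face contradicts nondegeneracy. -/
lemma core (F : Finset (ℕ × ℕ)) (c : ℕ × ℕ → ℂ) (hND : ND F c)
    (U : Ultrafilter ℕ) (x y : ℕ → ℂ) (hx : ∀ n, x n ≠ 0) (hy : ∀ n, y n ≠ 0)
    (hinf : Filter.Tendsto (fun n => max (Real.log ‖x n‖) (Real.log ‖y n‖)) U Filter.atTop)
    (v0 : ℕ × ℕ) (hv0 : v0 ∈ F)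
    (hdom : ∀ v ∈ F, ∀ᶠ n in (U : Filter ℕ),
      ‖x n ^ v.1 * y n ^ v.2‖ ≤ ‖x n ^ v0.1 * y n ^ v0.2‖)
    (ρ : ℕ × ℕ → ℂ)
    (hρ : ∀ v ∈ F, Filter.Tendsto
      (fun n => (x n ^ v.1 * y n ^ v.2) / (x n ^ v0.1 * y n ^ v0.2)) U (nhds (ρ v)))
    (hs0 : ∑ v ∈ F, c v * v.1 * ρ v = 0) (hs1 : ∑ v ∈ F, c v * v.2 * ρ v = 0)
    (v1 : ℕ × ℕ) (hv1 : v1 ∈ F) (hne : v1 ≠ v0) (hρ1 : ρ v1 ≠ 0) : False := by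
  set L1 : ℕ → ℝ := fun n => Real.log ‖x n‖ with hL1
  set L2 : ℕ → ℝ := fun n => Real.log ‖y n‖ with hL2
  set a : ℤ := (v1.1 : ℤ) - v0.1 with ha
  set b : ℤ := (v1.2 : ℤ) - v0.2 with hb
  have hmne : ∀ n (v : ℕ × ℕ), x n ^ v.1 * y n ^ v.2 ≠ 0 := fun n v =>
    mul_ne_zero (pow_ne_zero _ (hx n)) (pow_ne_zero _ (hy n))
  have hlogr : ∀ v : ℕ × ℕ, ∀ n,
      Real.log ‖(x n ^ v.1 * y n ^ v.2) / (x n ^ v0.1 * y n ^ v0.2)‖ =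
        ((v.1 : ℝ) - v0.1) * L1 n + ((v.2 : ℝ) - v0.2) * L2 n := by
    intro v n
    rw [norm_div, Real.log_div (norm_ne_zero_iff.2 (hmne n v)) (norm_ne_zero_iff.2 (hmne n v0)),
      norm_mono (hx n) (hy n), norm_mono (hx n) (hy n)]
    ring
  have har : (a : ℝ) = (v1.1 : ℝ) - v0.1 := by rw [ha]; push_cast; rfl
  have hbr : (b : ℝ) = (v1.2 : ℝ) - v0.2 := by rw [hb]; push_cast; rfl
  -- boundedness of `⟨L,u⟩`
  set w : ℕ → ℝ := fun n => (a : ℝ) * L1 n + b * L2 n with hw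
  have hwt : Filter.Tendsto w U (nhds (Real.log ‖ρ v1‖)) := by
    have := ((hρ v1 hv1).norm).log (norm_ne_zero_iff.2 hρ1)
    refine this.congr ?_
    intro n
    rw [hlogr, hw, har, hbr]
  set Λ : ℝ := |Real.log ‖ρ v1‖| + 1 with hΛ
  have hΛ0 : 0 ≤ Λ := by positivity
  have hwb : ∀ᶠ n in (U : Filter ℕ), |w n| ≤ Λ := by
    have := hwt.abs.eventually_lt_const (lt_add_one _)
    filter_upwards [this] with n hn using hn.le
  set N : ℝ := (a : ℝ) ^ 2 + (b : ℝ) ^ 2 with hN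
  have hab : a ≠ 0 ∨ b ≠ 0 := by
    by_contra hcon
    push Not at hcon
    exact hne (Prod.ext (by omega) (by omega))
  have hNpos : 0 < N := by
    rcases hab with h | h
    · have : (a : ℝ) ≠ 0 := by exact_mod_cast h
      positivity
    · have : (b : ℝ) ≠ 0 := by exact_mod_cast h
      positivity
  -- choice of the sign
  obtain ⟨σ, hσ, hτ⟩ : ∃ σ : ℤ, σ ^ 2 = 1 ∧
      ∀ᶠ n in (U : Filter ℕ), 0 ≤ (σ : ℝ) * (b * L1 n - a * L2 n) := by
    rcases U.em (fun n => 0 ≤ (b : ℝ) * L1 n - a * L2 n) with h | h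
    · exact ⟨1, by norm_num, by filter_upwards [h] with n hn; simpa using hn⟩
    · refine ⟨-1, by norm_num, ?_⟩
      filter_upwards [h] with n hn
      push_cast; linarith
  have hσr : (σ : ℝ) ^ 2 = 1 := by exact_mod_cast hσ
  set τ : ℕ → ℝ := fun n => (σ : ℝ) * (b * L1 n - a * L2 n) with hτd
  set m1 : ℤ := σ * b with hm1
  set m2 : ℤ := - (σ * a) with hm2
  have hm1r : (m1 : ℝ) = σ * b := by rw [hm1]; push_cast; rfl
  have hm2r : (m2 : ℝ) = - (σ * a) := by rw [hm2]; push_cast; rfl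
  have hNL1 : ∀ n, N * L1 n = a * w n + m1 * τ n := by
    intro n; rw [hm1r]; simp only [hN, hw, hτd]
    linear_combination (-(b : ℝ) * (b * L1 n - a * L2 n)) * hσr
  have hNL2 : ∀ n, N * L2 n = b * w n + m2 * τ n := by
    intro n; rw [hm2r]; simp only [hN, hw, hτd]
    linear_combination ((a : ℝ) * (b * L1 n - a * L2 n)) * hσr
  have hτt : Filter.Tendsto τ U Filter.atTop := by
    rw [Filter.tendsto_atTop]
    intro C
    set D : ℝ := (|(a : ℝ)| + |(b : ℝ)|) * (Λ + |C|) / N with hD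
    filter_upwards [hwb, hτ, hinf.eventually_gt_atTop D] with n h1 h2 h3
    by_contra hcon
    push Not at hcon
    have hτC : |τ n| ≤ |C| := by
      rw [abs_of_nonneg h2]; exact hcon.le.trans (le_abs_self C)
    have hσ1 : |(σ : ℝ)| = 1 := by
      have := (sq_eq_sq_iff_abs_eq_abs (σ : ℝ) 1).1 (by rw [hσr]; norm_num)
      rwa [abs_one] at this
    have hbound : ∀ p q : ℝ, p * w n + q * τ n ≤ |p| * Λ + |q| * |C| := by
      intro p q
      have e1 : p * w n ≤ |p| * Λ := (le_abs_self _).trans (by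
        rw [abs_mul]; exact mul_le_mul_of_nonneg_left h1 (abs_nonneg _))
      have e2 : q * τ n ≤ |q| * |C| := (le_abs_self _).trans (by
        rw [abs_mul]; exact mul_le_mul_of_nonneg_left hτC (abs_nonneg _))
      linarith
    have hm1a : |(m1 : ℝ)| = |(b : ℝ)| := by rw [hm1r, abs_mul, hσ1, one_mul]
    have hm2a : |(m2 : ℝ)| = |(a : ℝ)| := by rw [hm2r, abs_neg, abs_mul, hσ1, one_mul]
    have hA := abs_nonneg (a : ℝ)
    have hB := abs_nonneg (b : ℝ)
    have hCC := abs_nonneg C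
    have hND' : N * D = (|(a : ℝ)| + |(b : ℝ)|) * (Λ + |C|) := by
      rw [hD]; field_simp
    rcases lt_max_iff.1 h3 with h | h
    · have e := hbound a m1
      have f : N * D < N * L1 n := mul_lt_mul_of_pos_left h hNpos
      rw [hNL1 n] at f
      rw [hm1a] at e
      rw [hND', add_mul, mul_add, mul_add] at f
      linarith [mul_nonneg hA hCC, mul_nonneg hB hΛ0]
    · have e := hbound b m2
      have f : N * D < N * L2 n := mul_lt_mul_of_pos_left h hNpos
      rw [hNL2 n] at f
      rw [hm2a] at e
      rw [hND', add_mul, mul_add, mul_add] at f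
      linarith [mul_nonneg hB hCC, mul_nonneg hA hΛ0]
  -- the face
  have hpair : ∀ v : ℕ × ℕ, ∀ n,
      N * (((v.1 : ℝ) - v0.1) * L1 n + ((v.2 : ℝ) - v0.2) * L2 n) =
        w n * (a * ((v.1 : ℝ) - v0.1) + b * ((v.2 : ℝ) - v0.2)) +
          τ n * ((ip (m1, m2) v - ip (m1, m2) v0 : ℤ) : ℝ) := by
    intro v n
    simp only [ip]
    push_cast
    linear_combination ((v.1 : ℝ) - v0.1) * hNL1 n + ((v.2 : ℝ) - v0.2) * hNL2 n
  have hle : ∀ v ∈ F, ip (m1, m2) v ≤ ip (m1, m2) v0 := by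
    intro v hv
    by_contra hcon
    push Not at hcon
    have h1 : (1 : ℝ) ≤ ((ip (m1, m2) v - ip (m1, m2) v0 : ℤ) : ℝ) := by
      exact_mod_cast (by omega : (1 : ℤ) ≤ ip (m1, m2) v - ip (m1, m2) v0)
    set κ : ℝ := (a * ((v.1 : ℝ) - v0.1) + b * ((v.2 : ℝ) - v0.2)) with hκ
    obtain ⟨n, hn1, hn2, hn3, hn4⟩ := ((hdom v hv).and (hwb.and
      ((hτt.eventually_gt_atTop (Λ * |κ|)).and hτ))).exists
    have h2 := hpair v n
    have h3 : ((v.1 : ℝ) - v0.1) * L1 n + ((v.2 : ℝ) - v0.2) * L2 n ≤ 0 := by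
      rw [← hlogr]
      apply Real.log_nonpos (norm_nonneg _)
      rw [norm_div]
      exact div_le_one_of_le₀ hn1 (norm_nonneg _)
    have h4 : -(Λ * |κ|) ≤ w n * κ := by
      have : |w n * κ| ≤ Λ * |κ| := by
        rw [abs_mul]; exact mul_le_mul_of_nonneg_right hn2 (abs_nonneg _)
      exact (abs_le.1 this).1
    have h5 : τ n ≤ τ n * ((ip (m1, m2) v - ip (m1, m2) v0 : ℤ) : ℝ) :=
      le_mul_of_one_le_right hn4 h1
    have h6 := mul_nonpos_of_nonneg_of_nonpos hNpos.le h3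
    linarith
  have hzero : ∀ v ∈ F, ip (m1, m2) v ≠ ip (m1, m2) v0 → ρ v = 0 := by
    intro v hv hvne
    have h1 : ((ip (m1, m2) v - ip (m1, m2) v0 : ℤ) : ℝ) ≤ -1 := by
      have := hle v hv
      exact_mod_cast (by omega : ip (m1, m2) v - ip (m1, m2) v0 ≤ -1)
    set κ : ℝ := (a * ((v.1 : ℝ) - v0.1) + b * ((v.2 : ℝ) - v0.2)) with hκ
    by_contra hρv
    have ht := ((hρ v hv).norm).log (norm_ne_zero_iff.2 hρv)
    have ht' := ht.eventually_const_lt (sub_one_lt _)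
    set q := Real.log ‖ρ v‖ - 1
    obtain ⟨n, hn1, hn2, hn3, hn4⟩ := (ht'.and (hwb.and
      ((hτt.eventually_gt_atTop (Λ * |κ| - N * q)).and hτ))).exists
    rw [hlogr] at hn1
    have h2 := hpair v n
    have h4 : w n * κ ≤ Λ * |κ| := by
      have : |w n * κ| ≤ Λ * |κ| := by
        rw [abs_mul]; exact mul_le_mul_of_nonneg_right hn2 (abs_nonneg _)
      exact (abs_le.1 this).2
    have h5 : τ n * ((ip (m1, m2) v - ip (m1, m2) v0 : ℤ) : ℝ) ≤ τ n * (-1) :=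
      mul_le_mul_of_nonneg_left h1 hn4
    have h6 := mul_lt_mul_of_pos_left hn1 hNpos
    linarith
  have hpos : 0 < m1 ∨ 0 < m2 := by
    by_contra hcon
    push Not at hcon
    have h1 : (m1 : ℝ) ≤ 0 := by exact_mod_cast hcon.1
    have h2 : (m2 : ℝ) ≤ 0 := by exact_mod_cast hcon.2
    obtain ⟨n, hn1, hn2, hn3⟩ := (hwb.and ((hinf.eventually_gt_atTop
      ((|(a : ℝ)| + |(b : ℝ)|) * Λ / N)).and hτ)).exists
    have hτn : 0 ≤ τ n := hn3
    have e0 : ∀ p : ℝ, p * w n ≤ |p| * Λ := fun p => (le_abs_self _).trans (by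
        rw [abs_mul]; exact mul_le_mul_of_nonneg_left hn1 (abs_nonneg _))
    have hA := abs_nonneg (a : ℝ)
    have hB := abs_nonneg (b : ℝ)
    rcases lt_max_iff.1 hn2 with h | h
    · rw [div_lt_iff₀ hNpos, mul_comm (Real.log _), hNL1 n, add_mul] at h
      linarith [e0 a, mul_nonneg hB hΛ0, mul_nonpos_of_nonpos_of_nonneg h1 hτn]
    · rw [div_lt_iff₀ hNpos, mul_comm (Real.log _), hNL2 n, add_mul] at h
      linarith [e0 b, mul_nonneg hA hΛ0, mul_nonpos_of_nonpos_of_nonneg h2 hτn]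
  -- rescaled points
  set ξ : ℕ → ℂ := fun n => x n * (Real.exp (-(m1 * τ n / N)) : ℂ) with hξ
  set η : ℕ → ℂ := fun n => y n * (Real.exp (-(m2 * τ n / N)) : ℂ) with hη
  have hξn : ∀ n, ‖ξ n‖ = Real.exp (a * w n / N) := by
    intro n
    simp only [hξ]
    rw [norm_mul, Complex.norm_real, Real.norm_of_nonneg (Real.exp_pos _).le,
      ← Real.exp_log (norm_pos_iff.2 (hx n)), ← Real.exp_add]
    congr 1
    have := hNL1 n
    simp only [hL1] at this
    field_simp
    linarith
  have hηn : ∀ n, ‖η n‖ = Real.exp (b * w n / N) := by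
    intro n
    simp only [hη]
    rw [norm_mul, Complex.norm_real, Real.norm_of_nonneg (Real.exp_pos _).le,
      ← Real.exp_log (norm_pos_iff.2 (hy n)), ← Real.exp_add]
    congr 1
    have := hNL2 n
    simp only [hL2] at this
    field_simp
    linarith
  have hbd : ∀ p : ℝ, ∀ᶠ n in (U : Filter ℕ), Real.exp (-(|p| * Λ / N)) ≤ Real.exp (p * w n / N) ∧
      Real.exp (p * w n / N) ≤ Real.exp (|p| * Λ / N) := by
    intro p
    filter_upwards [hwb] with n hn
    have : |p * w n| ≤ |p| * Λ := by
      rw [abs_mul]; exact mul_le_mul_of_nonneg_left hn (abs_nonneg _)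
    rw [abs_le] at this
    rw [Real.exp_le_exp, Real.exp_le_exp, ← neg_div]
    exact ⟨div_le_div_of_nonneg_right this.1 hNpos.le,
      div_le_div_of_nonneg_right this.2 hNpos.le⟩
  obtain ⟨ξ0, hξ0, hξt⟩ := ultra_lim U ξ _ _ (by
    filter_upwards [hbd a] with n hn; rw [hξn n]; exact hn)
  obtain ⟨η0, hη0, hηt⟩ := ultra_lim U η _ _ (by
    filter_upwards [hbd b] with n hn; rw [hηn n]; exact hn)
  have hξ0' : ξ0 ≠ 0 := norm_pos_iff.1 (lt_of_lt_of_le (Real.exp_pos _) hξ0)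
  have hη0' : η0 ≠ 0 := norm_pos_iff.1 (lt_of_lt_of_le (Real.exp_pos _) hη0)
  have hmono : ∀ v : ℕ × ℕ, ∀ n, ξ n ^ v.1 * η n ^ v.2 =
      (x n ^ v.1 * y n ^ v.2) * (Real.exp (-(ip (m1, m2) v * τ n / N)) : ℂ) := by
    intro v n
    have : Real.exp (-(ip (m1, m2) v * τ n / N)) =
        Real.exp (-(m1 * τ n / N)) ^ v.1 * Real.exp (-(m2 * τ n / N)) ^ v.2 := by
      rw [← Real.exp_nat_mul, ← Real.exp_nat_mul, ← Real.exp_add]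
      congr 1
      simp only [ip]; push_cast; ring
    rw [this]
    simp only [hξ, hη]
    push_cast
    ring
  have hρv : ∀ v ∈ F, ip (m1, m2) v = ip (m1, m2) v0 →
      ρ v = (ξ0 ^ v.1 * η0 ^ v.2) / (ξ0 ^ v0.1 * η0 ^ v0.2) := by
    intro v hv hvip
    have h1 : Filter.Tendsto (fun n => (ξ n ^ v.1 * η n ^ v.2) / (ξ n ^ v0.1 * η n ^ v0.2)) U
        (nhds ((ξ0 ^ v.1 * η0 ^ v.2) / (ξ0 ^ v0.1 * η0 ^ v0.2))) :=
      ((hξt.pow _).mul (hηt.pow _)).div ((hξt.pow _).mul (hηt.pow _))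
        (mul_ne_zero (pow_ne_zero _ hξ0') (pow_ne_zero _ hη0'))
    refine tendsto_nhds_unique (hρ v hv) (h1.congr ?_)
    intro n
    rw [hmono, hmono, hvip, mul_div_mul_right]
    exact_mod_cast (Real.exp_pos _).ne'
  have hz0 : ξ0 ^ v0.1 * η0 ^ v0.2 ≠ 0 :=
    mul_ne_zero (pow_ne_zero _ hξ0') (pow_ne_zero _ hη0')
  have hsum : ∀ g : ℕ × ℕ → ℂ, ∑ v ∈ F, c v * g v * ρ v = 0 →
      ∑ v ∈ F.filter (fun v => ip (m1, m2) v = ip (m1, m2) v0),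
        c v * g v * (ξ0 ^ v.1 * η0 ^ v.2) = 0 := by
    intro g hg
    have : ∑ v ∈ F.filter (fun v => ip (m1, m2) v = ip (m1, m2) v0),
        c v * g v * (ξ0 ^ v.1 * η0 ^ v.2) = (ξ0 ^ v0.1 * η0 ^ v0.2) * ∑ v ∈ F, c v * g v * ρ v := by
      rw [Finset.sum_filter, Finset.mul_sum]
      apply Finset.sum_congr rfl
      intro v hv
      split_ifs with h
      · rw [hρv v hv h]; field_simp
      · rw [hzero v hv h]; simp
    rw [this, hg, mul_zero]
  refine hND (m1, m2) hpos v0 hv0 hle ⟨v1, hv1, hne, ?_⟩ ξ0 η0 hξ0' hη0' ?_ ?_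
  · by_contra h
    exact hρ1 (hzero v1 hv1 h)
  · have := hsum (fun v => v.1) hs0
    rw [← mul_G0] at this
    exact (mul_eq_zero.1 this).resolve_left hξ0'
  · have := hsum (fun v => v.2) hs1
    rw [← mul_G1] at this
    exact (mul_eq_zero.1 this).resolve_left hη0'

/-- the basic estimate: the logarithmic gradient dominates every monomial. -/
def Est (F : Finset (ℕ × ℕ)) (c : ℕ × ℕ → ℂ) : Prop :=
  ∃ k : ℝ, 0 < k ∧ ∃ R : ℝ, ∀ x y : ℂ, x ≠ 0 → y ≠ 0 → R ≤ max ‖x‖ ‖y‖ → ∀ v ∈ F,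
    k * ‖x ^ v.1 * y ^ v.2‖ ≤ ‖x * G0 F c x y‖ + ‖y * G1 F c x y‖

lemma est_of_ND (F : Finset (ℕ × ℕ)) (c : ℕ × ℕ → ℂ) (hc : ∀ v ∈ F, c v ≠ 0)
    (h00 : (0, 0) ∉ F) (hND : ND F c) : Est F c := by
  unfold Est
  by_contra hcon
  push Not at hcon
  have hch : ∀ n : ℕ, ∃ x y : ℂ, x ≠ 0 ∧ y ≠ 0 ∧ (n : ℝ) ≤ max ‖x‖ ‖y‖ ∧ ∃ v ∈ F,
      ‖x * G0 F c x y‖ + ‖y * G1 F c x y‖ < (1 / ((n : ℝ) + 1)) * ‖x ^ v.1 * y ^ v.2‖ := by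
    intro n
    exact hcon (1 / ((n : ℝ) + 1)) (by positivity) n
  choose x y hx hy hR hv using hch
  set U : Ultrafilter ℕ := Filter.hyperfilter ℕ with hU
  have hUle : (U : Filter ℕ) ≤ Filter.atTop := Nat.hyperfilter_le_atTop
  have hmne : ∀ n (v : ℕ × ℕ), x n ^ v.1 * y n ^ v.2 ≠ 0 := fun n v =>
    mul_ne_zero (pow_ne_zero _ (hx n)) (pow_ne_zero _ (hy n))
  have hw : ∀ n, ∃ w : F, (∀ v ∈ F, ‖x n ^ v.1 * y n ^ v.2‖ ≤ ‖x n ^ w.1.1 * y n ^ w.1.2‖) ∧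
      ‖x n * G0 F c (x n) (y n)‖ + ‖y n * G1 F c (x n) (y n)‖ ≤
        (1 / ((n : ℝ) + 1)) * ‖x n ^ w.1.1 * y n ^ w.1.2‖ := by
    intro n
    obtain ⟨v, hvF, hvn⟩ := hv n
    obtain ⟨w, hwF, hmax⟩ := F.exists_max_image (fun v => ‖x n ^ v.1 * y n ^ v.2‖) ⟨v, hvF⟩
    refine ⟨⟨w, hwF⟩, hmax, hvn.le.trans ?_⟩
    exact mul_le_mul_of_nonneg_left (hmax v hvF) (by positivity)
  choose w hw1 hw2 using hw
  obtain ⟨⟨v0, hv0⟩, hev⟩ : ∃ v0 : F, ∀ᶠ n in (U : Filter ℕ), w n = v0 := by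
    by_contra hno
    push Not at hno
    have h1 : ∀ v0 : F, ∀ᶠ n in (U : Filter ℕ), w n ≠ v0 := by
      intro v0
      exact hno v0
    have h2 := Filter.eventually_all.2 h1
    obtain ⟨n, hn⟩ := h2.exists
    exact hn (w n) rfl
  have hdom : ∀ v ∈ F, ∀ᶠ n in (U : Filter ℕ),
      ‖x n ^ v.1 * y n ^ v.2‖ ≤ ‖x n ^ v0.1 * y n ^ v0.2‖ := by
    intro v hv
    filter_upwards [hev] with n hn
    have := hw1 n v hv
    rwa [hn] at this
  have hlim : ∀ v : ℕ × ℕ, ∃ z : ℂ, v ∈ F → Filter.Tendsto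
      (fun n => (x n ^ v.1 * y n ^ v.2) / (x n ^ v0.1 * y n ^ v0.2)) U (nhds z) := by
    intro v
    by_cases hv : v ∈ F
    · obtain ⟨z, _, hz⟩ := ultra_lim U
        (fun n => (x n ^ v.1 * y n ^ v.2) / (x n ^ v0.1 * y n ^ v0.2)) 0 1 (by
          filter_upwards [hdom v hv] with n hn
          refine ⟨norm_nonneg _, ?_⟩
          rw [norm_div]
          exact div_le_one_of_le₀ hn (norm_nonneg _))
      exact ⟨z, fun _ => hz⟩
    · exact ⟨0, fun h => absurd h hv⟩
  choose ρ hρ using hlim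
  have hsmall : ∀ g : ℕ → ℂ, (∀ᶠ n in (U : Filter ℕ),
      ‖g n‖ ≤ (1 / ((n : ℝ) + 1)) * ‖x n ^ v0.1 * y n ^ v0.2‖) →
      Filter.Tendsto (fun n => g n / (x n ^ v0.1 * y n ^ v0.2)) U (nhds 0) := by
    intro g hg
    apply squeeze_zero_norm' _ (tendsto_one_div_add_atTop_nhds_zero_nat.mono_left hUle)
    filter_upwards [hg] with n hn
    rw [norm_div, div_le_iff₀ (norm_pos_iff.2 (hmne n v0))]
    exact hn
  have hsum : ∀ (d : ℕ × ℕ → ℂ), Filter.Tendsto (fun n =>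
      (∑ v ∈ F, d v * (x n ^ v.1 * y n ^ v.2)) / (x n ^ v0.1 * y n ^ v0.2)) U
      (nhds (∑ v ∈ F, d v * ρ v)) := by
    intro d
    have : Filter.Tendsto (fun n => ∑ v ∈ F,
        d v * ((x n ^ v.1 * y n ^ v.2) / (x n ^ v0.1 * y n ^ v0.2))) U
        (nhds (∑ v ∈ F, d v * ρ v)) :=
      tendsto_finsetSum _ (fun v hv => (hρ v hv).const_mul (d v))
    refine this.congr ?_
    intro n
    rw [Finset.sum_div]
    apply Finset.sum_congr rfl
    intro v _
    exact (mul_div_assoc _ _ _).symm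
  have hw3 : ∀ᶠ n in (U : Filter ℕ),
      ‖x n * G0 F c (x n) (y n)‖ + ‖y n * G1 F c (x n) (y n)‖ ≤
        (1 / ((n : ℝ) + 1)) * ‖x n ^ v0.1 * y n ^ v0.2‖ := by
    filter_upwards [hev] with n hn
    have := hw2 n
    rwa [hn] at this
  have hs0 : ∑ v ∈ F, c v * v.1 * ρ v = 0 := by
    refine tendsto_nhds_unique (hsum (fun v => c v * v.1)) ?_
    apply hsmall
    filter_upwards [hw3] with n hn
    rw [← mul_G0]
    linarith [norm_nonneg (y n * G1 F c (x n) (y n))]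
  have hs1 : ∑ v ∈ F, c v * v.2 * ρ v = 0 := by
    refine tendsto_nhds_unique (hsum (fun v => c v * v.2)) ?_
    apply hsmall
    filter_upwards [hw3] with n hn
    rw [← mul_G1]
    linarith [norm_nonneg (x n * G0 F c (x n) (y n))]
  by_cases hex : ∃ v1 ∈ F, v1 ≠ v0 ∧ ρ v1 ≠ 0
  · obtain ⟨v1, hv1, hne, hρ1⟩ := hex
    refine core F c hND U x y hx hy ?_ v0 hv0 hdom ρ hρ hs0 hs1 v1 hv1 hne hρ1
    have h1 : Filter.Tendsto (fun n : ℕ => Real.log (n : ℝ)) U Filter.atTop :=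
      (Real.tendsto_log_atTop.comp tendsto_natCast_atTop_atTop).mono_left hUle
    refine Filter.tendsto_atTop_mono' _ ?_ h1
    filter_upwards [hUle (Filter.eventually_gt_atTop 0)] with n hn
    have hn' : (0 : ℝ) < n := by exact_mod_cast hn
    rcases le_max_iff.1 (hR n) with h | h
    · exact (Real.log_le_log hn' h).trans (le_max_left _ _)
    · exact (Real.log_le_log hn' h).trans (le_max_right _ _)
  · push Not at hex
    have hρ0 : ρ v0 = 1 := by
      refine tendsto_nhds_unique (hρ v0 hv0) ?_
      have : (fun n => (x n ^ v0.1 * y n ^ v0.2) / (x n ^ v0.1 * y n ^ v0.2)) = fun _ => (1 : ℂ) := by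
        funext n; exact div_self (hmne n v0)
      rw [this]; exact tendsto_const_nhds
    rw [Finset.sum_eq_single_of_mem v0 hv0 (fun v hv hne => by rw [hex v hv hne, mul_zero]), hρ0]
      at hs0 hs1
    have hc0 := hc v0 hv0
    simp only [mul_one, mul_eq_zero, hc0, false_or, Nat.cast_eq_zero] at hs0 hs1
    apply h00
    have : v0 = (0, 0) := Prod.ext hs0 hs1
    rwa [← this]

lemma Est_sw {F : Finset (ℕ × ℕ)} {c : ℕ × ℕ → ℂ} (h : Est F c) : Est (swF F) (swc c) := by
  obtain ⟨k, hk, R, hE⟩ := h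
  refine ⟨k, hk, R, ?_⟩
  intro x y hx hy hR v hv
  have := hE y x hy hx (by rwa [max_comm]) v.swap (mem_swF.1 hv)
  rw [G0_sw, G1_sw]
  simp only [Prod.fst_swap, Prod.snd_swap] at this
  rw [mul_comm (x ^ v.1)]
  linarith

lemma lower_half (F : Finset (ℕ × ℕ)) (c : ℕ × ℕ → ℂ) (hc : ∀ v ∈ F, c v ≠ 0) (hE : Est F c)
    (b : ℝ)
    (hcomb : (∃ a : ℕ, (a, 0) ∈ F ∧ b ≤ a) ∨
      ∃ (p : ℕ) (δ : ℝ), (p, 1) ∈ F ∧ δ ≤ 1 ∧ b ≤ p + δ ∧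
      (∀ v ∈ F, v.2 = 1 → v.1 ≤ p) ∧ ∀ v ∈ F, 2 ≤ v.2 → v.1 + δ * ((v.2 : ℝ) - 1) ≤ p) :
    ∃ k : ℝ, 0 < k ∧ ∃ R : ℝ, ∀ x y : ℂ, ‖y‖ ≤ ‖x‖ → R ≤ ‖x‖ →
      k * ‖x‖ ^ (b - 1) ≤ max ‖G0 F c x y‖ ‖G1 F c x y‖ := by
  obtain ⟨k, hk, R, hE⟩ := hE
  have hE' : ∀ x y : ℂ, x ≠ 0 → R ≤ ‖x‖ → ∀ v ∈ F,
      k * ‖x ^ v.1 * y ^ v.2‖ ≤ ‖x * G0 F c x y‖ + ‖y * G1 F c x y‖ := by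
    intro x y hx hR v hv
    by_cases hy : y = 0
    · subst hy
      have hcl : Continuous fun y : ℂ => k * ‖x ^ v.1 * y ^ v.2‖ := by fun_prop
      have hcr : Continuous fun y : ℂ => ‖x * G0 F c x y‖ + ‖y * G1 F c x y‖ := by
        unfold G0 G1; fun_prop
      refine le_of_tendsto_of_tendsto
        ((hcl.tendsto 0).mono_left (nhdsWithin_le_nhds (s := {(0 : ℂ)}ᶜ)))
        ((hcr.tendsto 0).mono_left (nhdsWithin_le_nhds (s := {(0 : ℂ)}ᶜ))) ?_
      filter_upwards [self_mem_nhdsWithin] with y hy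
      exact hE x y hx hy (hR.trans (le_max_left _ _)) v hv
    · exact hE x y hx hy (hR.trans (le_max_left _ _)) v hv
  -- from a lower bound on a monomial
  have hfin : ∀ (x y : ℂ) (e : ℝ), 0 < e → ‖y‖ ≤ ‖x‖ → R ≤ ‖x‖ → 1 ≤ ‖x‖ → ∀ v ∈ F,
      e * ‖x‖ ^ b ≤ ‖x ^ v.1 * y ^ v.2‖ →
      (k * e / 2) * ‖x‖ ^ (b - 1) ≤ max ‖G0 F c x y‖ ‖G1 F c x y‖ := by
    intro x y e he hyx hR h1 v hv hM
    have hx0 : 0 < ‖x‖ := by linarith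
    have h2 := hE' x y (norm_pos_iff.1 hx0) hR v hv
    set m := max ‖G0 F c x y‖ ‖G1 F c x y‖ with hm
    have h3 : ‖x * G0 F c x y‖ ≤ ‖x‖ * m := by
      rw [norm_mul]; exact mul_le_mul_of_nonneg_left (le_max_left _ _) hx0.le
    have h4 : ‖y * G1 F c x y‖ ≤ ‖x‖ * m := by
      rw [norm_mul]
      exact mul_le_mul hyx (le_max_right _ _) (norm_nonneg _) hx0.le
    rw [Real.rpow_sub hx0, Real.rpow_one, ← mul_div_assoc, div_le_iff₀ hx0]
    have h5 := mul_le_mul_of_nonneg_left hM hk.le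
    linarith
  rcases hcomb with ⟨a, ha, hb⟩ | ⟨p, δ, hp, hδ, hb, hrow, hup⟩
  · refine ⟨k * 1 / 2, by positivity, max R 1, ?_⟩
    intro x y hyx hR
    have h1 : 1 ≤ ‖x‖ := (le_max_right _ _).trans hR
    refine hfin x y 1 one_pos hyx ((le_max_left _ _).trans hR) h1 (a, 0) ha ?_
    simp only [pow_zero, mul_one, one_mul, norm_pow]
    rw [← Real.rpow_natCast]
    exact Real.rpow_le_rpow_of_exponent_le h1 hb
  · set W : ℝ := ∑ v ∈ F, ‖c v‖ * v.2 with hW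
    have hW0 : 0 ≤ W := Finset.sum_nonneg (fun v _ => by positivity)
    set C : ℝ := ‖c (p, 1)‖ with hC
    have hC0 : 0 < C := norm_pos_iff.2 (hc _ hp)
    set ε : ℝ := min 1 (C / (2 * (W + 1))) with hε
    have hε0 : 0 < ε := lt_min one_pos (by positivity)
    have hε1 : ε ≤ 1 := min_le_left _ _
    have hεW : ε * W ≤ C / 2 := by
      have : ε ≤ C / (2 * (W + 1)) := min_le_right _ _
      rw [le_div_iff₀ (by positivity)] at this
      nlinarith
    refine ⟨min (C / 2) (k * ε / 2), lt_min (by positivity) (by positivity),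
      max R (max 1 (1 / ε)), ?_⟩
    intro x y hyx hR
    have hR1 : R ≤ ‖x‖ := (le_max_left _ _).trans hR
    have h1 : 1 ≤ ‖x‖ := ((le_max_left _ _).trans (le_max_right _ _)).trans hR
    have h1ε : 1 / ε ≤ ‖x‖ := ((le_max_right _ _).trans (le_max_right _ _)).trans hR
    rw [div_le_iff₀ hε0] at h1ε
    have hx0 : 0 < ‖x‖ := by linarith
    have hbp : 0 ≤ ‖x‖ ^ (b - 1) := Real.rpow_nonneg hx0.le _
    set X : ℝ := ‖x‖ with hX
    rcases le_or_gt ‖y‖ (ε * X ^ δ) with hy | hy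
    · refine le_trans (mul_le_mul_of_nonneg_right (min_le_left _ _) hbp) ?_
      have hXp : X ^ (b - 1) ≤ X ^ p := by
        rw [← Real.rpow_natCast]
        exact Real.rpow_le_rpow_of_exponent_le h1 (by linarith)
      have hterm : ∀ v ∈ F.erase (p, 1),
          ‖c v * v.2 * x ^ v.1 * y ^ (v.2 - 1)‖ ≤ (‖c v‖ * v.2) * (ε * X ^ p) := by
        intro v hv
        rw [Finset.mem_erase] at hv
        rw [norm_mul, norm_mul, norm_mul, norm_pow, norm_pow, Complex.norm_natCast, mul_assoc]
        by_cases hv0 : v.2 = 0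
        · simp [hv0]
        apply mul_le_mul_of_nonneg_left _ (by positivity)
        by_cases hv1 : v.2 = 1
        · have hvp : v.1 < p := by
            refine lt_of_le_of_ne (hrow v hv.2 hv1) ?_
            intro h; exact hv.1 (Prod.ext h hv1)
          rw [hv1]
          simp only [Nat.sub_self, pow_zero, mul_one]
          calc X ^ v.1 ≤ X ^ v.1 * (X * ε) := le_mul_of_one_le_right (by positivity) h1ε
            _ = ε * X ^ (v.1 + 1) := by ring
            _ ≤ ε * X ^ p :=
              mul_le_mul_of_nonneg_left (pow_le_pow_right₀ h1 hvp) hε0.le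
        · have hv2 : 2 ≤ v.2 := by omega
          calc X ^ v.1 * ‖y‖ ^ (v.2 - 1) ≤ X ^ v.1 * (ε * X ^ δ) ^ (v.2 - 1) := by gcongr
            _ = ε ^ (v.2 - 1) * X ^ ((v.1 : ℝ) + δ * ((v.2 : ℝ) - 1)) := by
              have hcast : (v.2 : ℝ) - 1 = ((v.2 - 1 : ℕ) : ℝ) := by
                rw [Nat.cast_sub (by omega), Nat.cast_one]
              rw [Real.rpow_add hx0, Real.rpow_natCast, Real.rpow_mul hx0.le,
                hcast, Real.rpow_natCast, mul_pow]
              ring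
            _ ≤ ε * X ^ (p : ℝ) := by
              apply mul_le_mul _ _ (Real.rpow_nonneg hx0.le _) hε0.le
              · calc ε ^ (v.2 - 1) ≤ ε ^ 1 := pow_le_pow_of_le_one hε0.le hε1 (by omega)
                  _ = ε := pow_one ε
              · exact Real.rpow_le_rpow_of_exponent_le h1 (hup v hv.2 hv2)
            _ = ε * X ^ p := by rw [Real.rpow_natCast]
      have hG : G1 F c x y = c (p, 1) * x ^ p +
          ∑ v ∈ F.erase (p, 1), c v * v.2 * x ^ v.1 * y ^ (v.2 - 1) := by
        unfold G1
        rw [← Finset.add_sum_erase F _ hp]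
        simp
      have hrest : ‖∑ v ∈ F.erase (p, 1), c v * v.2 * x ^ v.1 * y ^ (v.2 - 1)‖ ≤
          W * (ε * X ^ p) := by
        refine (norm_sum_le_of_le _ hterm).trans ?_
        rw [← Finset.sum_mul]
        apply mul_le_mul_of_nonneg_right _ (by positivity)
        exact Finset.sum_le_sum_of_subset_of_nonneg (Finset.erase_subset _ _)
          (fun v _ _ => by positivity)
      have hmain : ‖c (p, 1) * x ^ p‖ = C * X ^ p := by rw [norm_mul, norm_pow]
      have hlow : C * X ^ p - W * (ε * X ^ p) ≤ ‖G1 F c x y‖ := by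
        have := norm_sub_norm_le (c (p, 1) * x ^ p)
          (-∑ v ∈ F.erase (p, 1), c v * v.2 * x ^ v.1 * y ^ (v.2 - 1))
        rw [sub_neg_eq_add, ← hG, norm_neg, hmain] at this
        linarith
      refine le_trans ?_ (le_max_right _ _)
      have hXpos : 0 < X ^ p := by positivity
      have e1 : C / 2 * X ^ (b - 1) ≤ C / 2 * X ^ p := mul_le_mul_of_nonneg_left hXp (by positivity)
      have e2 := mul_le_mul_of_nonneg_right hεW hXpos.le
      linarith
    · refine le_trans (mul_le_mul_of_nonneg_right (min_le_right _ _) hbp) ?_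
      refine hfin x y ε hε0 hyx hR1 h1 (p, 1) hp ?_
      simp only [pow_one, norm_mul, norm_pow]
      calc ε * X ^ b ≤ ε * X ^ ((p : ℝ) + δ) :=
            mul_le_mul_of_nonneg_left (Real.rpow_le_rpow_of_exponent_le h1 hb) hε0.le
        _ = X ^ p * (ε * X ^ δ) := by rw [Real.rpow_add hx0, Real.rpow_natCast]; ring
        _ ≤ X ^ p * ‖y‖ := mul_le_mul_of_nonneg_left hy.le (by positivity)

/-! ### Faces and nondegeneracy -/

lemma faceR (F : Finset (ℕ × ℕ)) (n : ℤ × ℤ) (hn : 0 < n.1) (v0 : ℕ × ℕ) (hv0 : v0 ∈ F)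
    (hle : ∀ v ∈ F, ip n v ≤ ip n v0) (hex : ∃ v ∈ F, v ≠ v0 ∧ ip n v = ip n v0) :
    ∃ S, RS F S ∧ ∀ v ∈ F, OnSeg S v ↔ ip n v = ip n v0 := by
  obtain ⟨v1, hv1, hne, hv1ip⟩ := hex
  set T := F.filter (fun v => ip n v = ip n v0) with hT
  have hT0 : v0 ∈ T := by simp [hT, hv0]
  have hT1 : v1 ∈ T := by simp [hT, hv1, hv1ip]
  obtain ⟨P, hP, hPmin⟩ := T.exists_min_image (fun v => v.2) ⟨v0, hT0⟩
  obtain ⟨Q, hQ, hQmax⟩ := T.exists_max_image (fun v => v.2) ⟨v0, hT0⟩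
  have hne2 : v1.2 ≠ v0.2 := by
    intro h
    apply hne
    unfold ip at hv1ip
    rw [h] at hv1ip
    have h7 : n.1 * (v1.1 : ℤ) = n.1 * v0.1 := by linarith
    have h8 := mul_left_cancel₀ hn.ne' h7
    exact Prod.ext (by exact_mod_cast h8) h
  have hPQ : P.2 < Q.2 := by
    have a1 := hPmin _ hT0
    have a2 := hPmin _ hT1
    have a3 := hQmax _ hT0
    have a4 := hQmax _ hT1
    omega
  have hPF := (Finset.mem_filter.1 hP)
  have hQF := (Finset.mem_filter.1 hQ)
  have hlf : ∀ v : ℕ × ℕ, n.1 * (lfun ⟨P, Q⟩ P - lfun ⟨P, Q⟩ v) =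
      ((Q.2 : ℤ) - P.2) * (ip n v0 - ip n v) := by
    intro v
    have e1 := hPF.2
    have e2 := hQF.2
    simp only [ip, lfun] at *
    linear_combination ((Q.2 : ℤ) - v.2) * e1 + ((v.2 : ℤ) - P.2) * e2
  have hpos : (0 : ℤ) < (Q.2 : ℤ) - P.2 := by omega
  have hiff : ∀ v, lfun ⟨P, Q⟩ v = lfun ⟨P, Q⟩ P ↔ ip n v = ip n v0 := by
    intro v
    have := hlf v
    constructor
    · intro h
      rw [h, sub_self, mul_zero] at this
      have := (mul_eq_zero.1 this.symm).resolve_left hpos.ne'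
      linarith
    · intro h
      rw [h, sub_self, mul_zero] at this
      have := (mul_eq_zero.1 this).resolve_left hn.ne'
      linarith
  refine ⟨⟨P, Q⟩, ⟨hPF.1, hQF.1, hPQ, ?_, ?_⟩, ?_⟩
  · intro v hv
    have h1 := hlf v
    have h2 : 0 ≤ ((Q.2 : ℤ) - P.2) * (ip n v0 - ip n v) :=
      mul_nonneg hpos.le (sub_nonneg.2 (hle v hv))
    rw [← h1] at h2
    have := nonneg_of_mul_nonneg_right h2 hn
    simp only; linarith
  · intro v hv hvl
    have hvT : v ∈ T := by
      rw [hT, Finset.mem_filter]; exact ⟨hv, (hiff v).1 hvl⟩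
    exact ⟨hPmin v hvT, hQmax v hvT⟩
  · intro v hv
    constructor
    · intro h
      exact (hiff v).1 h.1
    · intro h
      have hvT : v ∈ T := by
        rw [hT, Finset.mem_filter]; exact ⟨hv, h⟩
      have b1 := hPmin v hvT
      have b2 := hQmax v hvT
      have hl := (hiff v).2 h
      refine ⟨hl, ?_, ?_, ?_, ?_⟩
      · simp only [lfun] at hl ⊢
        rw [min_le_iff]
        by_contra hcon
        push Not at hcon
        zify at *
        nlinarith [mul_nonneg (sub_nonneg.2 b1) (sub_pos.2 hcon.2).le,
          mul_nonneg (sub_nonneg.2 b2) (sub_pos.2 hcon.1).le,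
          mul_pos hpos (sub_pos.2 hcon.1), mul_pos hpos (sub_pos.2 hcon.2)]
      · simp only [lfun] at hl ⊢
        rw [le_max_iff]
        by_contra hcon
        push Not at hcon
        zify at *
        nlinarith [mul_nonneg (sub_nonneg.2 b1) (sub_pos.2 hcon.2).le,
          mul_nonneg (sub_nonneg.2 b2) (sub_pos.2 hcon.1).le,
          mul_pos hpos (sub_pos.2 hcon.1), mul_pos hpos (sub_pos.2 hcon.2)]
      · exact (min_le_left _ _).trans b1
      · exact b2.trans (le_max_right _ _)

lemma OnSeg_sw (S : Seg) (v : ℕ × ℕ) : OnSeg S.sw v ↔ OnSeg S v.swap := by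
  have h1 : lfun S.sw v = lfun S.sw S.sw.P ↔ lfun S v.swap = lfun S S.P := by
    simp only [lfun, Seg.sw, Prod.fst_swap, Prod.snd_swap]
    constructor <;> intro h <;> linarith
  unfold OnSeg
  rw [h1]
  simp only [Seg.sw, Prod.fst_swap, Prod.snd_swap]
  tauto

lemma ND_of_nondeg (h : MvPolynomial (Fin 2) ℂ)
    (hnd : ∀ S : Seg, RightSeg h S ∨ TopSeg h S → Nondeg h S) : ND (supp h) (coeff2 h) := by
  intro n hn v0 hv0 hle hex x y hx hy hg0 hg1
  obtain ⟨S, hS, hon⟩ : ∃ S, (RightSeg h S ∨ TopSeg h S) ∧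
      ∀ v ∈ supp h, OnSeg S v ↔ ip n v = ip n v0 := by
    rcases hn with hn | hn
    · obtain ⟨S, hS, hon⟩ := faceR (supp h) n hn v0 hv0 hle hex
      exact ⟨S, Or.inl hS, hon⟩
    · have hip : ∀ v : ℕ × ℕ, ip n.swap v = ip n v.swap := by
        intro v; simp [ip, add_comm]
      obtain ⟨S, hS, hon⟩ := faceR (swF (supp h)) n.swap hn v0.swap (mem_swF.2 (by simpa using hv0))
        (by intro v hv; rw [hip, hip]; simpa using hle _ (mem_swF.1 hv))
        (by
          obtain ⟨v, hv, hne, he⟩ := hex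
          refine ⟨v.swap, mem_swF.2 (by simpa using hv), ?_, ?_⟩
          · intro h; exact hne (Prod.swap_injective h)
          · rw [hip, hip]; simpa using he)
      refine ⟨S.sw, Or.inr ?_, ?_⟩
      · rw [topSeg_iff, sw_sw]; exact hS
      · intro v hv
        rw [OnSeg_sw, hon v.swap (mem_swF.2 (by simpa using hv)), hip, hip]
        simp
  apply hnd S hS
  have hfil : (supp h).filter (OnSeg S) = (supp h).filter (fun v => ip n v = ip n v0) :=
    Finset.filter_congr hon
  refine ⟨x, y, hx, hy, ?_, ?_⟩
  · unfold inPoly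
    rw [eval_pderiv0, hfil]; exact hg0
  · unfold inPoly
    rw [eval_pderiv1, hfil]; exact hg1

/-! ### Final assembly -/

lemma low_of_ndvd1 (h : MvPolynomial (Fin 2) ℂ) (hY : ¬ (MvPolynomial.X 1 ^ 2 ∣ h)) :
    ∃ v ∈ supp h, v.2 ≤ 1 := by
  by_contra hcon
  push Not at hcon
  apply hY
  rw [eq_sum_supp h]
  apply Finset.dvd_sum
  intro v hv
  have h2 := hcon v hv
  refine ⟨MvPolynomial.monomial (Finsupp.single 0 v.1 + Finsupp.single 1 (v.2 - 2)) (coeff2 h v), ?_⟩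
  rw [MvPolynomial.X_pow_eq_monomial, MvPolynomial.monomial_mul, one_mul]
  refine congrArg (fun d => MvPolynomial.monomial d (coeff2 h v)) ?_
  ext i; fin_cases i <;> simp
  omega

lemma low_of_ndvd0 (h : MvPolynomial (Fin 2) ℂ) (hX : ¬ (MvPolynomial.X 0 ^ 2 ∣ h)) :
    ∃ v ∈ supp h, v.1 ≤ 1 := by
  by_contra hcon
  push Not at hcon
  apply hX
  rw [eq_sum_supp h]
  apply Finset.dvd_sum
  intro v hv
  have h2 := hcon v hv
  refine ⟨MvPolynomial.monomial (Finsupp.single 0 (v.1 - 2) + Finsupp.single 1 v.2) (coeff2 h v), ?_⟩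
  rw [MvPolynomial.X_pow_eq_monomial, MvPolynomial.monomial_mul, one_mul]
  refine congrArg (fun d => MvPolynomial.monomial d (coeff2 h v)) ?_
  ext i; fin_cases i <;> simp
  omega

lemma up_of_pderiv1 (h : MvPolynomial (Fin 2) ℂ) (hd : MvPolynomial.pderiv (1 : Fin 2) h ≠ 0) :
    ∃ v ∈ supp h, 1 ≤ v.2 := by
  by_contra hcon
  push Not at hcon
  apply hd
  rw [eq_sum_supp h, map_sum]
  apply Finset.sum_eq_zero
  intro v hv
  have h2 : v.2 = 0 := by have := hcon v hv; omega
  rw [MvPolynomial.pderiv_monomial]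
  simp [h2]

lemma up_of_pderiv0 (h : MvPolynomial (Fin 2) ℂ) (hd : MvPolynomial.pderiv (0 : Fin 2) h ≠ 0) :
    ∃ v ∈ supp h, 1 ≤ v.1 := by
  by_contra hcon
  push Not at hcon
  apply hd
  rw [eq_sum_supp h, map_sum]
  apply Finset.sum_eq_zero
  intro v hv
  have h2 : v.1 = 0 := by have := hcon v hv; omega
  rw [MvPolynomial.pderiv_monomial]
  simp [h2]

lemma swap_ex {F : Finset (ℕ × ℕ)} {p : ℕ × ℕ → Prop} (h : ∃ v ∈ F, p v) :
    ∃ v ∈ swF F, p v.swap := by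
  obtain ⟨v, hv, hp⟩ := h
  exact ⟨v.swap, mem_swF.2 (by simpa using hv), by simpa using hp⟩

lemma mem_loja_iff (h : MvPolynomial (Fin 2) ℂ) (l : ℝ) : l ∈ lojaSet (gradMap h) ↔
    ∃ k : ℝ, 0 < k ∧ ∃ R : ℝ, ∀ x y : ℂ, R ≤ max ‖x‖ ‖y‖ → k * (max ‖x‖ ‖y‖) ^ l ≤
      max ‖G0 (supp h) (coeff2 h) x y‖ ‖G1 (supp h) (coeff2 h) x y‖ := by
  unfold lojaSet
  simp only [Set.mem_ofPred_eq, gradMap_eq, pnorm, Prod.forall]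

lemma final_lower (h : MvPolynomial (Fin 2) ℂ)
    (h00 : MvPolynomial.coeff 0 h = 0)
    (hdx : MvPolynomial.pderiv (0 : Fin 2) h ≠ 0)
    (hdy : MvPolynomial.pderiv (1 : Fin 2) h ≠ 0)
    (hX2 : ¬ (MvPolynomial.X 0 ^ 2 ∣ h))
    (hY2 : ¬ (MvPolynomial.X 1 ^ 2 ∣ h))
    (hne : (∃ S : Seg, RightSeg h S ∧ ¬ RExcep S) ∨
           (∃ S : Seg, TopSeg h S ∧ ¬ TExcep S))
    (hnd : ∀ S : Seg, RightSeg h S ∨ TopSeg h S → Nondeg h S) (b : ℝ)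
    (hR : ∀ S, RightSeg h S → ¬ RExcep S → b ≤ alphaS S)
    (hT : ∀ S, TopSeg h S → ¬ TExcep S → b ≤ betaS S) :
    b - 1 ∈ lojaSet (gradMap h) := by
  have hT' : ∀ S, RS (swF (supp h)) S → ¬ RExcep S → b ≤ alphaS S := by
    intro S hS hex
    have := hT S.sw (by rw [topSeg_iff, sw_sw]; exact hS) hex
    rwa [betaS_eq, sw_sw] at this
  have hdeg : ∃ v ∈ supp h, b ≤ (v.1 : ℝ) + v.2 := by
    rcases hne with ⟨S, hS, hex⟩ | ⟨S, hS, hex⟩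
    · exact deg_bound (supp h) b hR hT' S hS hex
    · have := deg_bound (swF (supp h)) b hT' (by rw [swF_swF]; exact hR) S.sw
        ((topSeg_iff h S).1 hS) hex
      obtain ⟨v, hv, hb⟩ := this
      refine ⟨v.swap, mem_swF.1 hv, ?_⟩
      simp only [Prod.fst_swap, Prod.snd_swap]; linarith
  have hc : ∀ v ∈ supp h, coeff2 h v ≠ 0 := fun v hv => (coeff2_ne h v).1 hv
  have hc' : ∀ v ∈ swF (supp h), swc (coeff2 h) v ≠ 0 := fun v hv => hc _ (mem_swF.1 hv)
  have h0 : (0, 0) ∉ supp h := by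
    rw [coeff2_ne]; simp [coeff2, h00]
  have hE := est_of_ND (supp h) (coeff2 h) hc h0 (ND_of_nondeg h hnd)
  have c1 := comb (supp h) b hR hdeg (low_of_ndvd1 h hY2) (up_of_pderiv1 h hdy)
  have c2 := comb (swF (supp h)) b hT'
    (by
      obtain ⟨v, hv, hb⟩ := swap_ex hdeg
      exact ⟨v, hv, by simp only [Prod.fst_swap, Prod.snd_swap] at hb; linarith⟩)
    (swap_ex (low_of_ndvd0 h hX2)) (swap_ex (up_of_pderiv0 h hdx))
  obtain ⟨k1, hk1, R1, l1⟩ := lower_half _ _ hc hE b c1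
  obtain ⟨k2, hk2, R2, l2⟩ := lower_half _ _ hc' (Est_sw hE) b c2
  rw [mem_loja_iff]
  refine ⟨min k1 k2, lt_min hk1 hk2, max R1 R2, ?_⟩
  intro x y hxy
  rcases le_total ‖y‖ ‖x‖ with hle | hle
  · rw [max_eq_left hle] at hxy ⊢
    exact (mul_le_mul_of_nonneg_right (min_le_left _ _) (Real.rpow_nonneg (norm_nonneg _) _)).trans
      (l1 x y hle ((le_max_left _ _).trans hxy))
  · rw [max_eq_right hle] at hxy ⊢
    have := l2 y x hle ((le_max_right _ _).trans hxy)
    rw [G0_sw, G1_sw, max_comm] at this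
    exact (mul_le_mul_of_nonneg_right (min_le_right _ _)
      (Real.rpow_nonneg (norm_nonneg _) _)).trans this

lemma final_upper (h : MvPolynomial (Fin 2) ℂ) (l : ℝ) (hl : l ∈ lojaSet (gradMap h)) :
    (∀ S, RightSeg h S → ¬ RExcep S → l ≤ (alphaS S : ℝ) - 1) ∧
    (∀ S, TopSeg h S → ¬ TExcep S → l ≤ (betaS S : ℝ) - 1) := by
  rw [mem_loja_iff] at hl
  have hc : ∀ v ∈ supp h, coeff2 h v ≠ 0 := fun v hv => (coeff2_ne h v).1 hv
  refine ⟨fun S hS hex => upper_right _ _ hc S hS hex l hl, fun S hS hex => ?_⟩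
  rw [betaS_eq]
  refine upper_right (swF (supp h)) (swc (coeff2 h)) (fun v hv => hc _ (mem_swF.1 hv)) S.sw
    ((topSeg_iff h S).1 hS) hex l ?_
  obtain ⟨k, hk, R, hl⟩ := hl
  refine ⟨k, hk, R, fun x y hR => ?_⟩
  rw [G0_sw, G1_sw, max_comm ‖x‖, max_comm ‖G1 _ _ _ _‖]
  exact hl y x (by rwa [max_comm])

/-- Theorem 2.1 (the main result): let `h` be a polynomial without constant term, with
non-zero gradient components, divisible neither by `X²` nor by `Y²`, such that the right
or top Newton polygon has a non-exceptional segment. Then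
`ℓ_∞(grad h) ≤ min{ inf_{S'} α(S'), inf_{S''} β(S'') } − 1`, where `S'` runs over the
non-exceptional segments of the right polygon and `S''` over those of the top polygon
(each infimum being `+∞` over the empty set); if moreover `h` is nondegenerate at
infinity, equality holds. -/
theorem stmt19 (h : MvPolynomial (Fin 2) ℂ)
    (h00 : MvPolynomial.coeff 0 h = 0)
    (hdx : MvPolynomial.pderiv (0 : Fin 2) h ≠ 0)
    (hdy : MvPolynomial.pderiv (1 : Fin 2) h ≠ 0)
    (hX2 : ¬ (MvPolynomial.X 0 ^ 2 ∣ h))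
    (hY2 : ¬ (MvPolynomial.X 1 ^ 2 ∣ h))
    (hne : (∃ S : Seg, RightSeg h S ∧ ¬ RExcep S) ∨
           (∃ S : Seg, TopSeg h S ∧ ¬ TExcep S))
    (B : EReal)
    (hB : B = min
      (sInf {x : EReal | ∃ S : Seg, RightSeg h S ∧ ¬ RExcep S ∧ x = ((alphaS S : ℝ) : EReal)})
      (sInf {x : EReal | ∃ S : Seg, TopSeg h S ∧ ¬ TExcep S ∧ x = ((betaS S : ℝ) : EReal)})) :
    loja (gradMap h) ≤ B - 1 ∧
    ((∀ S : Seg, RightSeg h S ∨ TopSeg h S → Nondeg h S) →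
      loja (gradMap h) = B - 1) := by
  have hup : loja (gradMap h) ≤ B - 1 := by
    unfold loja
    apply sSup_le
    rintro _ ⟨l, hl, rfl⟩
    obtain ⟨u1, u2⟩ := final_upper h l hl
    have hlB : ((l + 1 : ℝ) : EReal) ≤ B := by
      rw [hB]
      refine le_min (le_sInf ?_) (le_sInf ?_)
      · rintro _ ⟨S, hS, hex, rfl⟩
        rw [EReal.coe_le_coe_iff]; linarith [u1 S hS hex]
      · rintro _ ⟨S, hS, hex, rfl⟩
        rw [EReal.coe_le_coe_iff]; linarith [u2 S hS hex]
    have h2 : ((l + 1 : ℝ) : EReal) - 1 ≤ B - 1 := EReal.sub_le_sub hlB le_rfl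
    have h3 : ((l + 1 : ℝ) : EReal) - 1 = (l : EReal) := by
      rw [← EReal.coe_one, ← EReal.coe_sub]; congr 1; ring
    rw [h3] at h2
    exact h2
  refine ⟨hup, fun hnd => le_antisymm hup ?_⟩
  have hBR : ∀ S, RightSeg h S → ¬ RExcep S → B ≤ ((alphaS S : ℝ) : EReal) := fun S hS hex => by
    rw [hB]; exact (min_le_left _ _).trans (sInf_le ⟨S, hS, hex, rfl⟩)
  have hBT : ∀ S, TopSeg h S → ¬ TExcep S → B ≤ ((betaS S : ℝ) : EReal) := fun S hS hex => by
    rw [hB]; exact (min_le_right _ _).trans (sInf_le ⟨S, hS, hex, rfl⟩)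
  have hBtop : B ≠ ⊤ := by
    intro htop
    rcases hne with ⟨S, hS, hex⟩ | ⟨S, hS, hex⟩
    · have := hBR S hS hex
      rw [htop, top_le_iff] at this
      exact EReal.coe_ne_top _ this
    · have := hBT S hS hex
      rw [htop, top_le_iff] at this
      exact EReal.coe_ne_top _ this
  clear hB hup
  induction B with
  | bot => simp
  | top => exact absurd rfl hBtop
  | coe b =>
    have hmem := final_lower h h00 hdx hdy hX2 hY2 hne hnd b
      (fun S hS hex => EReal.coe_le_coe_iff.1 (hBR S hS hex))
      (fun S hS hex => EReal.coe_le_coe_iff.1 (hBT S hS hex))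
    have h3 : (b : EReal) - 1 = ((b - 1 : ℝ) : EReal) := by
      rw [← EReal.coe_one, ← EReal.coe_sub]
    rw [h3]
    exact le_sSup ⟨b - 1, hmem, rfl⟩
end
end
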